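/- Large deviations bound for the cancellation terms. Assume that the compact set K of Borel probability measures on SL(d,ℝ) satisfies the finite moment condition, the measures condition, and the spaces condition. Fix a unit vector v₀ ∈ ℝ^d. For n = km, define B_j = A_{kj} ⋯ A_{k(j−1)+1} for j = 1, …, m, define unit vectors v_j recursively by v_j = B_j v_{j−1} / |B_j v_{j−1}|, and set R_j = log‖B_j‖ − log|B_j v_{j−1}|. Then for any ε'' > 0 there exists k₁ = k₁(ε''), such that for any k > k₁ there exist δ'' > 0 and C'' such that for all m and all choices of μ₁, …, μ_{km} ∈ K and all unit v₀, ℙ( R₁ + R₂ + ⋯ + R_m > kmε'' ) < C'' e^{−δ'' m}, where ℙ = μ₁ × ⋯ × μ_{km}. -/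

import Mathlib

open MeasureTheory Matrix Filter
open scoped ENNReal

noncomputable section

/-- `SL(d, ℝ)`. -/
abbrev SL (d : ℕ) := Matrix.SpecialLinearGroup (Fin d) ℝ

instance (d : ℕ) : TopologicalSpace (SL d) :=
  inferInstanceAs (TopologicalSpace { A : Matrix (Fin d) (Fin d) ℝ // A.det = 1 })

instance (d : ℕ) : MeasurableSpace (SL d) := borel _
instance (d : ℕ) : BorelSpace (SL d) := ⟨rfl⟩

/-- Operator norm of a real `d × d` matrix, acting on Euclidean space. -/
def opNorm {d : ℕ} (A : Matrix (Fin d) (Fin d) ℝ) : ℝ :=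
  ‖Matrix.toEuclideanCLM (𝕜 := ℝ) A‖

/-- The norm `‖A‖` of `A ∈ SL(d, ℝ)`. -/
def slNorm {d : ℕ} (A : SL d) : ℝ := opNorm (A : Matrix (Fin d) (Fin d) ℝ)

/-- `A` applied to a vector `v ∈ ℝ^d` (with the Euclidean norm). -/
def slVec {d : ℕ} (A : SL d) (v : EuclideanSpace ℝ (Fin d)) : EuclideanSpace ℝ (Fin d) :=
  Matrix.toEuclideanCLM (𝕜 := ℝ) (A : Matrix (Fin d) (Fin d) ℝ) v

/-- The random (reversed) product `Tₙ = Aₙ ⋯ A₂ A₁`, where `Aᵢ = ω (i-1)`. -/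
def T {d : ℕ} (ω : ℕ → SL d) : ℕ → SL d
  | 0 => 1
  | n + 1 => ω n * T ω n

/-- The projective space `ℝP^{d-1}`. -/
abbrev Proj (d : ℕ) := Projectivization ℝ (Fin d → ℝ)

instance (d : ℕ) : TopologicalSpace (Proj d) :=
  inferInstanceAs (TopologicalSpace (Quotient (projectivizationSetoid ℝ (Fin d → ℝ))))

instance (d : ℕ) : MeasurableSpace (Proj d) := borel _
instance (d : ℕ) : BorelSpace (Proj d) := ⟨rfl⟩

/-- The linear map induced by `A ∈ SL(d, ℝ)` is injective. -/
theorem toLin'_injective {d : ℕ} (A : SL d) :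
    Function.Injective (Matrix.toLin' (A : Matrix (Fin d) (Fin d) ℝ)) := by
  apply Function.LeftInverse.injective
    (g := Matrix.toLin' ((A⁻¹ : SL d) : Matrix (Fin d) (Fin d) ℝ))
  intro x
  rw [← Matrix.toLin'_mul_apply, ← Matrix.SpecialLinearGroup.coe_mul, inv_mul_cancel,
    Matrix.SpecialLinearGroup.coe_one, Matrix.toLin'_one, LinearMap.id_apply]

/-- The projective map `f_A : ℝP^{d-1} → ℝP^{d-1}` induced by `A ∈ SL(d, ℝ)`. -/
def projMap {d : ℕ} (A : SL d) : Proj d → Proj d :=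
  Projectivization.map (Matrix.toLin' (A : Matrix (Fin d) (Fin d) ℝ)) (toLin'_injective A)

/-- The subset `[L] ⊆ ℝP^{d-1}` corresponding to a linear subspace `L ≤ ℝ^d`. -/
def projSet {d : ℕ} (L : Submodule ℝ (Fin d → ℝ)) : Set (Proj d) :=
  {x : Proj d | x.submodule ≤ L}

/-- Finite moment condition for a single measure, with exponent `γ` and bound `C`. -/
def FiniteMomentCondition {d : ℕ} (γ C : ℝ) (μ : ProbabilityMeasure (SL d)) : Prop :=
  ∫⁻ A, ENNReal.ofReal (slNorm A ^ γ) ∂(μ : Measure (SL d)) < ENNReal.ofReal C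

/-- Log-moment condition: `∫ log ‖A‖ dμ(A) < ∞`. -/
def LogMomentCondition {d : ℕ} (μ : ProbabilityMeasure (SL d)) : Prop :=
  ∫⁻ A, ENNReal.ofReal (Real.log (slNorm A)) ∂(μ : Measure (SL d)) < ⊤

/-- Measures condition: there are no Borel probability measures `ν₁`, `ν₂` on `ℝP^{d-1}`
with `(f_A)_* ν₁ = ν₂` for `μ`-a.e. `A`. -/
def MeasuresCondition {d : ℕ} (μ : ProbabilityMeasure (SL d)) : Prop :=
  ¬ ∃ (ν₁ ν₂ : ProbabilityMeasure (Proj d)),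
      ∀ᵐ A ∂(μ : Measure (SL d)),
        (ν₁ : Measure (Proj d)).map (projMap A) = (ν₂ : Measure (Proj d))

/-- `U ⊆ ℝ^d` is a (nonempty) finite union of proper nonzero linear subspaces. -/
def IsFiniteUnionOfProperSubspaces {d : ℕ} (U : Set (Fin d → ℝ)) : Prop :=
  ∃ S : Set (Submodule ℝ (Fin d → ℝ)), S.Finite ∧ S.Nonempty ∧
    (∀ W ∈ S, W ≠ ⊥ ∧ W ≠ ⊤) ∧ U = ⋃ W ∈ S, (W : Set (Fin d → ℝ))

/-- `U ⊆ ℝ^d` is a (nonempty) finite union of `j`-dimensional linear subspaces. -/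
def IsFiniteUnionOfDimSubspaces {d : ℕ} (j : ℕ) (U : Set (Fin d → ℝ)) : Prop :=
  ∃ S : Set (Submodule ℝ (Fin d → ℝ)), S.Finite ∧ S.Nonempty ∧
    (∀ W ∈ S, Module.finrank ℝ W = j) ∧ U = ⋃ W ∈ S, (W : Set (Fin d → ℝ))

/-- Spaces condition: there are no two finite unions `U`, `U'` of proper nonzero subspaces
of `ℝ^d` such that `A(U) = U'` for `μ`-a.e. `A`. -/
def SpacesCondition {d : ℕ} (μ : ProbabilityMeasure (SL d)) : Prop :=
  ¬ ∃ U U' : Set (Fin d → ℝ), IsFiniteUnionOfProperSubspaces U ∧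
      IsFiniteUnionOfProperSubspaces U' ∧
      ∀ᵐ (A : SL d) ∂(μ : Measure (SL d)),
        (fun v => Matrix.toLin' (A : Matrix (Fin d) (Fin d) ℝ) v) '' U = U'

/-- `ℙ` is the product measure `μ₁ × μ₂ × ⋯` on sequences, characterized by its
finite-dimensional marginals. -/
def IsProductMeasure {d : ℕ} (μ : ℕ → ProbabilityMeasure (SL d))
    (ℙ : Measure (ℕ → SL d)) : Prop :=
  IsProbabilityMeasure ℙ ∧
    ∀ n : ℕ, ℙ.map (fun ω (i : Fin n) => ω i) =
      Measure.pi (fun i : Fin n => ((μ i : Measure (SL d))))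

/-- `Lₙ = E log ‖Tₙ‖`. -/
def L {d : ℕ} (ℙ : Measure (ℕ → SL d)) (n : ℕ) : ℝ :=
  ∫ ω, Real.log (slNorm (T ω n)) ∂ℙ

/-- `L_{[n,m]} = E log ‖A_m ⋯ A_{n+1}‖`. -/
def Lseg {d : ℕ} (ℙ : Measure (ℕ → SL d)) (n m : ℕ) : ℝ :=
  ∫ ω, Real.log (slNorm (T ω m * (T ω n)⁻¹)) ∂ℙ

/-- The block product `B_j = A_{kj} ⋯ A_{k(j-1)+1}` (here `j` is 0-indexed, so `Bblk k ω j`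
is the paper's `B_{j+1}`). -/
def Bblk {d : ℕ} (k : ℕ) (ω : ℕ → SL d) (j : ℕ) : SL d :=
  T ω (k * (j + 1)) * (T ω (k * j))⁻¹

/-- The sequence of normalized images `v_j` of the initial unit vector `v₀`. -/
def vseq {d : ℕ} (k : ℕ) (ω : ℕ → SL d) (v₀ : EuclideanSpace ℝ (Fin d)) :
    ℕ → EuclideanSpace ℝ (Fin d)
  | 0 => v₀
  | j + 1 => ‖slVec (Bblk k ω j) (vseq k ω v₀ j)‖⁻¹ • slVec (Bblk k ω j) (vseq k ω v₀ j)

/-- The cancellation term `R_j = log ‖B_j‖ - log |B_j v_{j-1}|` (0-indexed in `j`). -/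
def Rterm {d : ℕ} (k : ℕ) (ω : ℕ → SL d) (v₀ : EuclideanSpace ℝ (Fin d)) (j : ℕ) : ℝ :=
  Real.log (slNorm (Bblk k ω j)) - Real.log ‖slVec (Bblk k ω j) (vseq k ω v₀ j)‖

theorem isEmbedding_coe_SL (d : ℕ) :
    Topology.IsEmbedding (fun A : SL d => ((A : Matrix (Fin d) (Fin d) ℝ) : Fin d → Fin d → ℝ)) :=
  Topology.IsEmbedding.subtypeVal

theorem continuous_coe_SL (d : ℕ) :
    Continuous (fun A : SL d => (A : Matrix (Fin d) (Fin d) ℝ)) :=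
  continuous_subtype_val

instance (d : ℕ) : IsTopologicalGroup (SL d) where
  continuous_mul := by
    refine Continuous.subtype_mk (p := fun A : Matrix (Fin d) (Fin d) ℝ => A.det = 1) ?_ _
    exact ((continuous_coe_SL d).comp continuous_fst).matrix_mul
      ((continuous_coe_SL d).comp continuous_snd)
  continuous_inv := by
    refine Continuous.subtype_mk (p := fun A : Matrix (Fin d) (Fin d) ℝ => A.det = 1) ?_ _
    exact (continuous_coe_SL d).matrix_adjugate

instance (d : ℕ) : SecondCountableTopology (SL d) :=
  haveI : SecondCountableTopology (Matrix (Fin d) (Fin d) ℝ) :=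
    inferInstanceAs (SecondCountableTopology (Fin d → Fin d → ℝ))
  (isEmbedding_coe_SL d).secondCountableTopology

instance (d : ℕ) : TopologicalSpace.MetrizableSpace (SL d) :=
  haveI : TopologicalSpace.MetrizableSpace (Matrix (Fin d) (Fin d) ℝ) :=
    inferInstanceAs (TopologicalSpace.MetrizableSpace (Fin d → Fin d → ℝ))
  (isEmbedding_coe_SL d).metrizableSpace

theorem slVec_mul {d : ℕ} (A B : SL d) (v : EuclideanSpace ℝ (Fin d)) :
    slVec (A * B) v = slVec A (slVec B v) := by
  simp [slVec]

theorem slVec_one {d : ℕ} (v : EuclideanSpace ℝ (Fin d)) : slVec (1 : SL d) v = v := by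
  simp [slVec]

theorem slVec_inv_cancel {d : ℕ} (A : SL d) (v : EuclideanSpace ℝ (Fin d)) :
    slVec A⁻¹ (slVec A v) = v := by
  rw [← slVec_mul, inv_mul_cancel, slVec_one]

theorem slVec_ne_zero {d : ℕ} (A : SL d) {v : EuclideanSpace ℝ (Fin d)} (hv : v ≠ 0) :
    slVec A v ≠ 0 := by
  intro h
  apply hv
  rw [← slVec_inv_cancel A v, h]
  simp [slVec]

theorem slVec_smul {d : ℕ} (A : SL d) (c : ℝ) (v : EuclideanSpace ℝ (Fin d)) :
    slVec A (c • v) = c • slVec A v := by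
  simp [slVec]

theorem continuous_toEuclideanCLM_SL (d : ℕ) :
    Continuous (fun A : SL d => Matrix.toEuclideanCLM (𝕜 := ℝ) (A : Matrix (Fin d) (Fin d) ℝ)) :=
  (LinearMap.continuous_of_finiteDimensional
    ((Matrix.toEuclideanCLM (n := Fin d) (𝕜 := ℝ)).toAlgEquiv.toLinearMap)).comp
    (continuous_coe_SL d)

theorem continuous_slNorm (d : ℕ) : Continuous (slNorm : SL d → ℝ) :=
  (continuous_toEuclideanCLM_SL d).norm

theorem norm_slVec_le {d : ℕ} (A : SL d) (v : EuclideanSpace ℝ (Fin d)) :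
    ‖slVec A v‖ ≤ slNorm A * ‖v‖ :=
  ContinuousLinearMap.le_opNorm _ _

theorem slNorm_mul_le {d : ℕ} (A B : SL d) : slNorm (A * B) ≤ slNorm A * slNorm B := by
  simp only [slNorm, opNorm, Matrix.SpecialLinearGroup.coe_mul, map_mul]
  exact norm_mul_le _ _

theorem slNorm_nonneg {d : ℕ} (A : SL d) : 0 ≤ slNorm A := norm_nonneg _

theorem abs_entry_le_slNorm {d : ℕ} (A : SL d) (i j : Fin d) :
    |(A : Matrix (Fin d) (Fin d) ℝ) i j| ≤ slNorm A := by
  have h := norm_slVec_le A (EuclideanSpace.single j 1)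
  have h3 := PiLp.norm_apply_le (slVec A (EuclideanSpace.single j 1)) i
  have h4 : (slVec A (EuclideanSpace.single j 1)) i = (A : Matrix (Fin d) (Fin d) ℝ) i j := by
    rw [slVec, ofLp_toEuclideanCLM]; simp
  rw [h4] at h3
  simp only [PiLp.norm_single, norm_one, mul_one] at h
  exact h3.trans h

/-- A crude bound of the operator norm by the entries. -/
theorem opNorm_le_of_entry_le {d : ℕ} (M : Matrix (Fin d) (Fin d) ℝ) {b : ℝ} 
    (h : ∀ i j, |M i j| ≤ b) : opNorm M ≤ (d * d : ℝ) * b := by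
  have hM : Matrix.toEuclideanCLM (n := Fin d) (𝕜 := ℝ) M = ∑ i, ∑ j, 
      M i j • Matrix.toEuclideanCLM (n := Fin d) (𝕜 := ℝ) (Matrix.single i j 1) := by
    conv_lhs => rw [Matrix.matrix_eq_sum_single M]
    simp only [map_sum, ← map_smul]
    simp
  have hs : ∀ i j : Fin d, 
      ‖Matrix.toEuclideanCLM (n := Fin d) (𝕜 := ℝ) (Matrix.single i j 1)‖ ≤ 1 := by
    intro i j
    refine ContinuousLinearMap.opNorm_le_bound _ zero_le_one fun v => ?_
    have : Matrix.toEuclideanCLM (n := Fin d) (𝕜 := ℝ) (Matrix.single i j 1) v = 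
        EuclideanSpace.single i (v j) := by
      ext k
      rw [ofLp_toEuclideanCLM]
      simp [Matrix.single_mulVec, Function.update_apply]
    rw [this, PiLp.norm_single, one_mul]
    exact PiLp.norm_apply_le v j
  rw [opNorm, hM]
  calc _ ≤ ∑ i : Fin d, ∑ j : Fin d, b := by
        refine (norm_sum_le _ _).trans (Finset.sum_le_sum fun i _ => ?_)
        refine (norm_sum_le _ _).trans (Finset.sum_le_sum fun j _ => ?_)
        rw [norm_smul]
        exact (mul_le_of_le_one_right (norm_nonneg _) (hs i j)).trans (h i j)
    _ = _ := by simp; ring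

theorem exists_slNorm_inv_le (d : ℕ) :
    ∃ c : ℝ, 1 ≤ c ∧ ∀ A : SL d, slNorm A⁻¹ ≤ c * (max 1 (slNorm A)) ^ d := by
  refine ⟨max 1 ((d * d : ℝ) * d.factorial), le_max_left _ _, fun A => ?_⟩
  have h : ∀ i j, |((A⁻¹ : SL d) : Matrix (Fin d) (Fin d) ℝ) i j| ≤
      d.factorial * (max 1 (slNorm A)) ^ d := by
    intro i j
    rw [Matrix.SpecialLinearGroup.coe_inv, Matrix.adjugate_apply]
    have := Matrix.det_le (R := ℝ) (abv := IsAbsoluteValue.toAbsoluteValue (abs : ℝ → ℝ)) 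
      (A := (A : Matrix (Fin d) (Fin d) ℝ).updateRow j (Pi.single i 1))
      (x := max 1 (slNorm A)) ?_
    · simpa using this
    · intro a b
      rw [Matrix.updateRow_apply]
      split_ifs
      · rw [Pi.single_apply]
        split_ifs <;> simp
      · exact (abs_entry_le_slNorm A a b).trans (le_max_right _ _)
  refine (opNorm_le_of_entry_le _ h).trans ?_
  rw [← mul_assoc]
  gcongr
  exact le_max_right _ _

/-- The condition number `‖A‖ ‖A⁻¹‖`. -/
def slCond {d : ℕ} (A : SL d) : ℝ := slNorm A * slNorm A⁻¹

/-- The cancellation `log ‖A‖ - log |A v|`. -/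
def slDefect {d : ℕ} (A : SL d) (v : EuclideanSpace ℝ (Fin d)) : ℝ :=
  Real.log (slNorm A) - Real.log ‖slVec A v‖

/-- The unit sphere of `ℝ^d`. -/
abbrev Sph (d : ℕ) : Type := Metric.sphere (0 : EuclideanSpace ℝ (Fin d)) 1

theorem Sph.norm_coe {d : ℕ} (x : Sph d) : ‖(x : EuclideanSpace ℝ (Fin d))‖ = 1 :=
  mem_sphere_zero_iff_norm.1 x.2

theorem Sph.coe_ne_zero {d : ℕ} (x : Sph d) : (x : EuclideanSpace ℝ (Fin d)) ≠ 0 :=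
  norm_ne_zero_iff.1 (by rw [Sph.norm_coe x]; exact one_ne_zero)

theorem norm_slVec_pos {d : ℕ} (A : SL d) (x : Sph d) :
    0 < ‖slVec A (x : EuclideanSpace ℝ (Fin d))‖ :=
  norm_pos_iff.2 (slVec_ne_zero A (Sph.coe_ne_zero x))

/-- The action of `SL(d, ℝ)` on the unit sphere. -/
def sphAct {d : ℕ} (A : SL d) (x : Sph d) : Sph d :=
  ⟨‖slVec A (x : EuclideanSpace ℝ (Fin d))‖⁻¹ • slVec A (x : EuclideanSpace ℝ (Fin d)), by
    rw [mem_sphere_zero_iff_norm, norm_smul, norm_inv, norm_norm,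
      inv_mul_cancel₀ (norm_slVec_pos A x).ne']⟩

theorem continuous_slVec_coe (d : ℕ) :
    Continuous (fun p : SL d × Sph d => slVec p.1 (p.2 : EuclideanSpace ℝ (Fin d))) := by
  unfold slVec
  have h1 : Continuous (fun p : SL d × Sph d =>
      Matrix.toEuclideanCLM (𝕜 := ℝ) (p.1 : Matrix (Fin d) (Fin d) ℝ)) :=
    (continuous_toEuclideanCLM_SL d).comp continuous_fst
  have h2 : Continuous (fun p : SL d × Sph d => (p.2 : EuclideanSpace ℝ (Fin d))) :=
    continuous_subtype_val.comp continuous_snd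
  exact h1.clm_apply h2

theorem continuous_sphAct (d : ℕ) : Continuous (fun p : SL d × Sph d => sphAct p.1 p.2) := by
  have h := continuous_slVec_coe d
  exact ((h.norm.inv₀ fun p => (norm_slVec_pos p.1 p.2).ne').smul h).subtype_mk _

theorem slVec_eq_smul_sphAct {d : ℕ} (A : SL d) (x : Sph d) :
    slVec A (x : EuclideanSpace ℝ (Fin d)) =
      ‖slVec A (x : EuclideanSpace ℝ (Fin d))‖ • (sphAct A x : EuclideanSpace ℝ (Fin d)) := by
  rw [sphAct, smul_smul, mul_inv_cancel₀ (norm_slVec_pos A x).ne', one_smul]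

theorem norm_slVec_mul {d : ℕ} (A B : SL d) (x : Sph d) :
    ‖slVec (A * B) (x : EuclideanSpace ℝ (Fin d))‖ =
      ‖slVec B (x : EuclideanSpace ℝ (Fin d))‖ *
        ‖slVec A (sphAct B x : EuclideanSpace ℝ (Fin d))‖ := by
  rw [slVec_mul, slVec_eq_smul_sphAct B x, slVec_smul, norm_smul, norm_norm, norm_smul,
    norm_norm, Sph.norm_coe, mul_one]

theorem sphAct_mul {d : ℕ} (A B : SL d) (x : Sph d) :
    sphAct (A * B) x = sphAct A (sphAct B x) := by
  apply Subtype.ext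
  have hB := (norm_slVec_pos B x).ne'
  have h := slVec_eq_smul_sphAct B x
  change ‖slVec (A * B) (x : EuclideanSpace ℝ (Fin d))‖⁻¹ • slVec (A * B) _ =
    ‖slVec A (sphAct B x : EuclideanSpace ℝ (Fin d))‖⁻¹ • slVec A _
  rw [norm_slVec_mul, slVec_mul]
  nth_rewrite 2 [h]
  rw [slVec_smul, smul_smul, mul_inv, mul_assoc, mul_comm, mul_assoc, mul_inv_cancel₀ hB, mul_one]

theorem slNorm_pos {d : ℕ} (hd : 0 < d) (A : SL d) : 0 < slNorm A := by
  have h := norm_slVec_le A (EuclideanSpace.single ⟨0, hd⟩ 1)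
  have h1 : slVec A (EuclideanSpace.single (⟨0, hd⟩ : Fin d) 1) ≠ 0 := by
    apply slVec_ne_zero
    rw [← norm_ne_zero_iff]
    simp
  simp only [PiLp.norm_single, norm_one, mul_one] at h
  exact (norm_pos_iff.2 h1).trans_le h

theorem norm_slVec_le_slNorm {d : ℕ} (A : SL d) (x : Sph d) :
    ‖slVec A (x : EuclideanSpace ℝ (Fin d))‖ ≤ slNorm A := by
  simpa [Sph.norm_coe] using norm_slVec_le A x

theorem slNorm_le_slCond_mul_norm {d : ℕ} (A : SL d) (x : Sph d) :
    slNorm A ≤ slCond A * ‖slVec A (x : EuclideanSpace ℝ (Fin d))‖ := by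
  have h := norm_slVec_le A⁻¹ (slVec A (x : EuclideanSpace ℝ (Fin d)))
  rw [slVec_inv_cancel, Sph.norm_coe] at h
  rw [slCond, mul_assoc]
  exact le_mul_of_one_le_right (slNorm_nonneg A) h

theorem slCond_mul_le {d : ℕ} (A B : SL d) : slCond (A * B) ≤ slCond A * slCond B := by
  rw [slCond, slCond, slCond, _root_.mul_inv_rev]
  calc _ ≤ (slNorm A * slNorm B) * (slNorm B⁻¹ * slNorm A⁻¹) :=
        mul_le_mul (slNorm_mul_le _ _) (slNorm_mul_le _ _) (slNorm_nonneg _)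
          (mul_nonneg (slNorm_nonneg _) (slNorm_nonneg _))
    _ = _ := by ring

theorem continuous_slCond (d : ℕ) : Continuous (slCond : SL d → ℝ) :=
  (continuous_slNorm d).mul ((continuous_slNorm d).comp continuous_inv)

theorem nonempty_Sph {d : ℕ} (hd : 0 < d) : Nonempty (Sph d) :=
  ⟨⟨EuclideanSpace.single ⟨0, hd⟩ 1, by simp⟩⟩

theorem one_le_slCond {d : ℕ} (hd : 0 < d) (A : SL d) : 1 ≤ slCond A := by
  obtain ⟨x⟩ := nonempty_Sph hd
  have h := norm_slVec_le A⁻¹ (slVec A (x : EuclideanSpace ℝ (Fin d)))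
  rw [slVec_inv_cancel, Sph.norm_coe] at h
  rw [slCond, mul_comm]
  exact h.trans (mul_le_mul_of_nonneg_left (norm_slVec_le_slNorm A x) (slNorm_nonneg _))

theorem slDefect_nonneg {d : ℕ} (A : SL d) (x : Sph d) : 0 ≤ slDefect A x :=
  sub_nonneg.2 (Real.log_le_log (norm_slVec_pos A x) (norm_slVec_le_slNorm A x))

theorem slDefect_le_log_slCond {d : ℕ} (hd : 0 < d) (A : SL d) (x : Sph d) :
    slDefect A x ≤ Real.log (slCond A) := by
  have h := Real.log_le_log (slNorm_pos hd A) (slNorm_le_slCond_mul_norm A x)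
  rw [Real.log_mul (zero_lt_one.trans_le (one_le_slCond hd A)).ne' (norm_slVec_pos A x).ne'] at h
  rw [slDefect]
  linarith

theorem slDefect_mul_le {d : ℕ} (hd : 0 < d) (A B : SL d) (x : Sph d) :
    slDefect (A * B) x ≤ slDefect B x + slDefect A (sphAct B x) := by
  have h := Real.log_le_log (slNorm_pos hd (A * B)) (slNorm_mul_le A B)
  rw [Real.log_mul (slNorm_pos hd A).ne' (slNorm_pos hd B).ne'] at h
  simp only [slDefect]
  rw [norm_slVec_mul, Real.log_mul (norm_slVec_pos B x).ne' (norm_slVec_pos A _).ne']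
  linarith

theorem continuous_slDefect {d : ℕ} (hd : 0 < d) :
    Continuous (fun p : SL d × Sph d => slDefect p.1 p.2) := by
  have h := continuous_slVec_coe d
  exact (((continuous_slNorm d).comp continuous_fst).log fun p => (slNorm_pos hd p.1).ne').sub
    (h.norm.log fun p => (norm_slVec_pos p.1 p.2).ne')

/-- The most expanded direction of `A` controls the expansion in all the others. -/
theorem exists_slNorm_mul_abs_inner_le {d : ℕ} (hd : 0 < d) (A : SL d) :
    ∃ u : Sph d, ∀ x : EuclideanSpace ℝ (Fin d),
      slNorm A * |inner ℝ (u : EuclideanSpace ℝ (Fin d)) x| ≤ ‖slVec A x‖ := by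
  set F := Matrix.toEuclideanCLM (n := Fin d) (𝕜 := ℝ) (A : Matrix (Fin d) (Fin d) ℝ) with hF
  obtain ⟨x₀⟩ := nonempty_Sph hd
  obtain ⟨y, hy, hmax⟩ := (isCompact_sphere (0 : EuclideanSpace ℝ (Fin d)) 1).exists_isMaxOn
    ⟨x₀, x₀.2⟩ (F.adjoint.continuous.norm.continuousOn)
  rw [mem_sphere_zero_iff_norm] at hy
  have hnorm : ‖F.adjoint y‖ = slNorm A := by
    apply le_antisymm
    · have := F.adjoint.le_opNorm y
      rw [hy, mul_one, LinearIsometryEquiv.norm_map] at this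
      exact this
    · change ‖F‖ ≤ _
      rw [← LinearIsometryEquiv.norm_map ContinuousLinearMap.adjoint F]
      exact ContinuousLinearMap.opNorm_le_of_unit_norm (norm_nonneg _) fun x hx =>
        hmax (mem_sphere_zero_iff_norm.2 hx)
  have hpos := slNorm_pos hd A
  refine ⟨⟨(slNorm A)⁻¹ • F.adjoint y, ?_⟩, fun x => ?_⟩
  · rw [mem_sphere_zero_iff_norm, norm_smul, hnorm, norm_inv, Real.norm_of_nonneg hpos.le,
      inv_mul_cancel₀ hpos.ne']
  · change slNorm A * |inner ℝ ((slNorm A)⁻¹ • F.adjoint y) x| ≤ ‖F x‖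
    rw [real_inner_smul_left, abs_mul, abs_inv, abs_of_pos hpos, ← mul_assoc,
      mul_inv_cancel₀ hpos.ne', one_mul, ContinuousLinearMap.adjoint_inner_left]
    simpa [hy] using abs_real_inner_le_norm y (F x)

theorem exists_slDefect_le_neg_log_abs_inner {d : ℕ} (hd : 0 < d) (A : SL d) :
    ∃ u : Sph d, ∀ (x : Sph d) (η : ℝ), 0 < η →
      η ≤ |inner ℝ (u : EuclideanSpace ℝ (Fin d)) x| → slDefect A x ≤ -Real.log η := by
  obtain ⟨u, hu⟩ := exists_slNorm_mul_abs_inner_le hd A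
  refine ⟨u, fun x η hη hx => ?_⟩
  have h := Real.log_le_log (mul_pos (slNorm_pos hd A) hη)
    ((mul_le_mul_of_nonneg_left hx (slNorm_nonneg A)).trans (hu x))
  rw [Real.log_mul (slNorm_pos hd A).ne' hη.ne'] at h
  rw [slDefect]
  linarith

/-- A finite moment of the norm gives a finite moment of the condition number. -/
theorem exists_lintegral_slCond_rpow_le {d : ℕ} (hd : 0 < d) {γ : ℝ} (hγ : 0 < γ) (C : ℝ) :
    ∃ β : ℝ, 0 < β ∧ ∃ M : ℝ, 1 ≤ M ∧ ∀ μ : ProbabilityMeasure (SL d),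
      FiniteMomentCondition γ C μ →
        ∫⁻ A, ENNReal.ofReal (slCond A ^ β) ∂(μ : Measure (SL d)) ≤ ENNReal.ofReal M := by
  obtain ⟨c, hc, hinv⟩ := exists_slNorm_inv_le d
  have hd1 : (0 : ℝ) < (d + 1 : ℕ) := by positivity
  set β := γ / (d + 1 : ℕ) with hβ
  have hβ0 : 0 < β := by positivity
  have hc0 : (0 : ℝ) < c := by linarith
  have hcβ : 1 ≤ c ^ β := Real.one_le_rpow hc hβ0.le
  have hpt : ∀ A : SL d, slCond A ^ β ≤ c ^ β * (1 + slNorm A ^ γ) := by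
    intro A
    have h0 := slNorm_nonneg A
    have h1 : slCond A ≤ c * max 1 (slNorm A) ^ (d + 1) := by
      rw [slCond, pow_succ]
      calc slNorm A * slNorm A⁻¹ ≤ max 1 (slNorm A) * (c * max 1 (slNorm A) ^ d) :=
            mul_le_mul (le_max_right _ _) (hinv A) (slNorm_nonneg _) (by positivity)
        _ = _ := by ring
    have h2 : (0 : ℝ) ≤ max 1 (slNorm A) := by positivity
    calc slCond A ^ β ≤ (c * max 1 (slNorm A) ^ (d + 1)) ^ β :=
          Real.rpow_le_rpow (zero_le_one.trans (one_le_slCond hd A)) h1 hβ0.le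
      _ = c ^ β * max 1 (slNorm A) ^ γ := by
          rw [Real.mul_rpow hc0.le (by positivity), ← Real.rpow_natCast, ← Real.rpow_mul h2, hβ,
            mul_div_cancel₀ _ hd1.ne']
      _ ≤ _ := by
          gcongr
          rcases max_cases 1 (slNorm A) with ⟨h, -⟩ | ⟨h, -⟩ <;> rw [h]
          · rw [Real.one_rpow]
            exact le_add_of_nonneg_right (Real.rpow_nonneg h0 _)
          · exact le_add_of_nonneg_left zero_le_one
  refine ⟨β, hβ0, c ^ β * (1 + max C 0), ?_, fun μ hμ => ?_⟩
  · exact one_le_mul_of_one_le_of_one_le hcβ (le_add_of_nonneg_right (le_max_right _ _))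
  · calc ∫⁻ A, ENNReal.ofReal (slCond A ^ β) ∂(μ : Measure (SL d))
        ≤ ∫⁻ A, ENNReal.ofReal (c ^ β) * (1 + ENNReal.ofReal (slNorm A ^ γ))
            ∂(μ : Measure (SL d)) := by
          refine lintegral_mono fun A => ?_
          rw [← ENNReal.ofReal_one, ← ENNReal.ofReal_add zero_le_one
            (Real.rpow_nonneg (slNorm_nonneg A) _), ← ENNReal.ofReal_mul (by positivity)]
          exact ENNReal.ofReal_le_ofReal (hpt A)
      _ = ENNReal.ofReal (c ^ β) *
            (1 + ∫⁻ A, ENNReal.ofReal (slNorm A ^ γ) ∂(μ : Measure (SL d))) := by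
          rw [lintegral_const_mul' _ _ ENNReal.ofReal_ne_top, lintegral_add_left measurable_const]
          simp
      _ ≤ ENNReal.ofReal (c ^ β) * (1 + ENNReal.ofReal (max C 0)) := by
          gcongr
          exact hμ.le.trans (ENNReal.ofReal_le_ofReal (le_max_left _ _))
      _ = _ := by
          rw [← ENNReal.ofReal_one, ← ENNReal.ofReal_add zero_le_one (le_max_right _ _),
            ← ENNReal.ofReal_mul (by positivity)]

/-- The stationary-type convolution: the law of `A x` when `A ∼ μ` and `x ∼ ν` are independent. -/
def convSph {d : ℕ} (μ : ProbabilityMeasure (SL d)) (ν : ProbabilityMeasure (Sph d)) :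
    ProbabilityMeasure (Sph d) :=
  (μ.prod ν).map (f := fun p : SL d × Sph d => sphAct p.1 p.2)
    (continuous_sphAct d).measurable.aemeasurable

theorem continuous_convSph (d : ℕ) :
    Continuous (fun p : ProbabilityMeasure (SL d) × ProbabilityMeasure (Sph d) =>
      convSph p.1 p.2) :=
  (ProbabilityMeasure.continuous_map (continuous_sphAct d)).comp ProbabilityMeasure.continuous_prod

theorem toMeasure_convSph {d : ℕ} (μ : ProbabilityMeasure (SL d)) (ν : ProbabilityMeasure (Sph d)) :
    (convSph μ ν : Measure (Sph d)) =
      ((μ : Measure (SL d)).prod (ν : Measure (Sph d))).map fun p => sphAct p.1 p.2 := rfl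

theorem convSph_apply {d : ℕ} (μ : ProbabilityMeasure (SL d)) (ν : ProbabilityMeasure (Sph d))
    {s : Set (Sph d)} (hs : MeasurableSet s) :
    (convSph μ ν : Measure (Sph d)) s =
      ∫⁻ A, (ν : Measure (Sph d)) (sphAct A ⁻¹' s) ∂(μ : Measure (SL d)) := by
  rw [toMeasure_convSph, Measure.map_apply (continuous_sphAct d).measurable hs,
    Measure.prod_apply ((continuous_sphAct d).measurable hs)]
  rfl

/-- The laws that can be reached after `n` steps driven by measures in `K`. -/
def reach {d : ℕ} (K : Set (ProbabilityMeasure (SL d))) : ℕ → Set (ProbabilityMeasure (Sph d))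
  | 0 => Set.univ
  | n + 1 => Set.image2 convSph K (reach K n)

theorem reach_succ_subset {d : ℕ} (K : Set (ProbabilityMeasure (SL d))) (n : ℕ) :
    reach K (n + 1) ⊆ reach K n := by
  induction n with
  | zero => exact Set.subset_univ _
  | succ n ih => exact Set.image2_subset_left ih

theorem isCompact_reach {d : ℕ} {K : Set (ProbabilityMeasure (SL d))} (hK : IsCompact K) (n : ℕ) :
    IsCompact (reach K n) := by
  induction n with
  | zero => exact isCompact_univ
  | succ n ih =>
    rw [reach, ← Set.image_prod]
    exact (hK.prod ih).image (continuous_convSph d)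

theorem exists_convSph_of_mem_iInter_reach {d : ℕ} {K : Set (ProbabilityMeasure (SL d))}
    (hK : IsCompact K) {ν : ProbabilityMeasure (Sph d)} (hν : ν ∈ ⋂ n, reach K n) :
    ∃ μ ∈ K, ∃ ν' ∈ ⋂ n, reach K n, convSph μ ν' = ν := by
  have hcl : IsClosed {p : ProbabilityMeasure (SL d) × ProbabilityMeasure (Sph d) |
      convSph p.1 p.2 = ν} := isClosed_singleton.preimage (continuous_convSph d)
  have hcomp : ∀ n, IsCompact ((K ×ˢ reach K n) ∩ {p | convSph p.1 p.2 = ν}) := fun n =>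
    (hK.prod (isCompact_reach hK n)).inter_right hcl
  obtain ⟨p, hp⟩ := IsCompact.nonempty_iInter_of_sequence_nonempty_isCompact_isClosed
    (fun n => (K ×ˢ reach K n) ∩ {p | convSph p.1 p.2 = ν})
    (fun n => Set.inter_subset_inter_left _ (Set.prod_mono_right (reach_succ_subset K n)))
    (fun n => by
      obtain ⟨μ, hμ, ν', hν', h⟩ := Set.mem_iInter.1 hν (n + 1)
      exact ⟨(μ, ν'), ⟨hμ, hν'⟩, h⟩)
    (hcomp 0) (fun n => (hcomp n).isClosed)
  rw [Set.mem_iInter] at hp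
  exact ⟨p.1, (hp 0).1.1, p.2, Set.mem_iInter.2 fun n => (hp n).1.2, (hp 0).2⟩

theorem upperSemicontinuous_measure_section {X Y : Type*}
    [TopologicalSpace X] [TopologicalSpace.PseudoMetrizableSpace X] [SecondCountableTopology X]
    [MeasurableSpace X] [BorelSpace X]
    [TopologicalSpace Y] [TopologicalSpace.PseudoMetrizableSpace Y] [SecondCountableTopology Y]
    [MeasurableSpace Y] [BorelSpace Y] {F : Set (X × Y)} (hF : IsClosed F) :
    UpperSemicontinuous fun p : ProbabilityMeasure Y × X =>
      (p.1 : Measure Y) (Prod.mk p.2 ⁻¹' F) := by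
  have hcont : Continuous fun p : ProbabilityMeasure Y × X => (diracProba p.2).prod p.1 :=
    ProbabilityMeasure.continuous_prod.comp
      ((continuous_diracProba.comp continuous_snd).prodMk continuous_fst)
  have heq : ∀ p : ProbabilityMeasure Y × X, (p.1 : Measure Y) (Prod.mk p.2 ⁻¹' F) =
      (((diracProba p.2).prod p.1 : ProbabilityMeasure (X × Y)) : Measure (X × Y)) F := by
    intro p
    rw [ProbabilityMeasure.toMeasure_prod, Measure.prod_apply hF.measurableSet]
    exact (lintegral_dirac' p.2 (measurable_measure_prodMk_left hF.measurableSet)).symm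
  intro p y hy
  simp only [heq] at hy ⊢
  exact Filter.eventually_lt_of_limsup_lt
    ((ProbabilityMeasure.limsup_measure_closed_le_of_tendsto (hcont.tendsto p) hF).trans_lt hy)

/-- The mass given by `ν` to the directions contained in the subspace `W`. -/
def subMass {d : ℕ} (ν : ProbabilityMeasure (Sph d))
    (W : Submodule ℝ (EuclideanSpace ℝ (Fin d))) : ℝ≥0∞ :=
  (ν : Measure (Sph d)) {x | (x : EuclideanSpace ℝ (Fin d)) ∈ W}

theorem measurableSet_coe_mem {d : ℕ} (W : Submodule ℝ (EuclideanSpace ℝ (Fin d))) :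
    MeasurableSet {x : Sph d | (x : EuclideanSpace ℝ (Fin d)) ∈ W} :=
  (W.closed_of_finiteDimensional.preimage continuous_subtype_val).measurableSet

theorem exists_orthonormal_orthogonal_span_eq {d j : ℕ}
    (W : Submodule ℝ (EuclideanSpace ℝ (Fin d))) (hW : Module.finrank ℝ W = j) :
    ∃ u : Fin (d - j) → EuclideanSpace ℝ (Fin d), Orthonormal ℝ u ∧
      (Submodule.span ℝ (Set.range u))ᗮ = W := by
  have hdim : Module.finrank ℝ Wᗮ = d - j := by
    have := W.finrank_add_finrank_orthogonal
    rw [finrank_euclideanSpace_fin] at this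
    omega
  let b := (stdOrthonormalBasis ℝ Wᗮ).reindex (finCongr hdim)
  refine ⟨fun i => (b i : EuclideanSpace ℝ (Fin d)), ?_, ?_⟩
  · exact b.orthonormal.comp_linearIsometry Wᗮ.subtypeₗᵢ
  · have hr : Set.range (fun i => (b i : EuclideanSpace ℝ (Fin d))) =
        Wᗮ.subtype '' Set.range b := by
      rw [← Set.range_comp]; rfl
    rw [hr, Submodule.span_image, ← b.coe_toBasis, b.toBasis.span_eq, Submodule.map_top,
      Submodule.range_subtype, Submodule.orthogonal_orthogonal]

theorem finrank_orthogonal_span_of_orthonormal {d j : ℕ} (hj : j ≤ d)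
    {u : Fin (d - j) → EuclideanSpace ℝ (Fin d)} (hu : Orthonormal ℝ u) :
    Module.finrank ℝ ((Submodule.span ℝ (Set.range u))ᗮ : Submodule ℝ _) = j := by
  have h := (Submodule.span ℝ (Set.range u)).finrank_add_finrank_orthogonal
  rw [finrank_span_eq_card hu.linearIndependent, Fintype.card_fin, finrank_euclideanSpace_fin] at h
  omega

theorem mem_orthogonal_span_range_iff {d r : ℕ} (u : Fin r → EuclideanSpace ℝ (Fin d))
    (x : EuclideanSpace ℝ (Fin d)) :
    x ∈ (Submodule.span ℝ (Set.range u))ᗮ ↔ ∀ i, inner ℝ (u i) x = 0 := by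
  rw [Submodule.mem_orthogonal]
  constructor
  · exact fun h i => h _ (Submodule.subset_span (Set.mem_range_self i))
  · intro h y hy
    induction hy using Submodule.span_induction with
    | mem y hy => obtain ⟨i, rfl⟩ := hy; exact h i
    | zero => exact inner_zero_left _
    | add y z _ _ hy hz => rw [inner_add_left, hy, hz, add_zero]
    | smul c y _ hy => rw [inner_smul_left, hy, mul_zero]

theorem isCompact_orthonormal_family (d r : ℕ) :
    IsCompact {u : Fin r → EuclideanSpace ℝ (Fin d) | Orthonormal ℝ u} := by
  refine Metric.isCompact_of_isClosed_isBounded ?_ ?_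
  · have : {u : Fin r → EuclideanSpace ℝ (Fin d) | Orthonormal ℝ u} =
        {u | ∀ i j, inner ℝ (u i) (u j) = if i = j then (1 : ℝ) else 0} := by
      ext u
      exact orthonormal_iff_ite
    rw [this]
    simp only [Set.ofPred_forall]
    exact isClosed_iInter fun i => isClosed_iInter fun j =>
      isClosed_eq ((continuous_apply i).inner (continuous_apply j)) continuous_const
  · refine (Metric.isBounded_closedBall (x := 0) (r := 1)).subset fun u hu => ?_
    rw [mem_closedBall_zero_iff, pi_norm_le_iff_of_nonneg zero_le_one]
    exact fun i => (hu.1 i).le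

/-- The mass of `j`-dimensional subspaces attains its maximum over a compact set of measures. -/
theorem exists_forall_subMass_le {d j : ℕ} (hj : j ≤ d) {S : Set (ProbabilityMeasure (Sph d))}
    (hS : IsCompact S) (hne : S.Nonempty) :
    ∃ ν ∈ S, ∃ W : Submodule ℝ (EuclideanSpace ℝ (Fin d)), Module.finrank ℝ W = j ∧
      ∀ ν' ∈ S, ∀ W' : Submodule ℝ (EuclideanSpace ℝ (Fin d)), Module.finrank ℝ W' = j →
        subMass ν' W' ≤ subMass ν W := by
  have hF : IsClosed {p : (Fin (d - j) → EuclideanSpace ℝ (Fin d)) × Sph d |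
      ∀ i, inner ℝ (p.1 i) (p.2 : EuclideanSpace ℝ (Fin d)) = 0} := by
    simp only [Set.ofPred_forall]
    refine isClosed_iInter fun i => isClosed_eq ?_ continuous_const
    exact ((continuous_apply i).comp continuous_fst).inner
      (continuous_subtype_val.comp continuous_snd)
  have hmass : ∀ (ν : ProbabilityMeasure (Sph d)) (u : Fin (d - j) → EuclideanSpace ℝ (Fin d)),
      (ν : Measure (Sph d)) (Prod.mk u ⁻¹'
        {p : (Fin (d - j) → EuclideanSpace ℝ (Fin d)) × Sph d |
          ∀ i, inner ℝ (p.1 i) (p.2 : EuclideanSpace ℝ (Fin d)) = 0}) =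
      subMass ν (Submodule.span ℝ (Set.range u))ᗮ := by
    intro ν u
    rw [subMass]
    congr 1
    ext x
    exact (mem_orthogonal_span_range_iff u x).symm
  obtain ⟨V, hV⟩ : ∃ V : Submodule ℝ (EuclideanSpace ℝ (Fin d)), Module.finrank ℝ V = j := by
    obtain ⟨s, hs, hli⟩ := exists_finset_linearIndependent_of_le_finrank
      (R := ℝ) (M := EuclideanSpace ℝ (Fin d)) (n := j) (by rwa [finrank_euclideanSpace_fin])
    refine ⟨Submodule.span ℝ (s : Set (EuclideanSpace ℝ (Fin d))), ?_⟩
    rw [finrank_span_finset_eq_card hli, hs]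
  obtain ⟨u₀, hu₀, -⟩ := exists_orthonormal_orthogonal_span_eq V hV
  obtain ⟨p, ⟨hp1, hp2⟩, hmax⟩ := UpperSemicontinuousOn.exists_isMaxOn
    (hne.prod ⟨u₀, hu₀⟩) (hS.prod (isCompact_orthonormal_family d (d - j)))
    ((upperSemicontinuous_measure_section hF).upperSemicontinuousOn _)
  refine ⟨p.1, hp1, _, finrank_orthogonal_span_of_orthonormal hj hp2, fun ν' hν' W' hW' => ?_⟩
  obtain ⟨u', hu', rfl⟩ := exists_orthonormal_orthogonal_span_eq W' hW'
  have := hmax (Set.mk_mem_prod hν' hu')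
  simpa only [Set.mem_ofPred_eq, hmass] using this

/-- `A ∈ SL(d, ℝ)` as a linear automorphism of Euclidean space. -/
def slEquiv {d : ℕ} (A : SL d) : EuclideanSpace ℝ (Fin d) ≃ₗ[ℝ] EuclideanSpace ℝ (Fin d) where
  toFun := slVec A
  invFun := slVec A⁻¹
  map_add' := fun x y => by simp [slVec]
  map_smul' := fun c x => slVec_smul A c x
  left_inv := slVec_inv_cancel A
  right_inv := fun x => by simpa using slVec_inv_cancel A⁻¹ x

theorem sphAct_mem_iff {d : ℕ} (A : SL d) (x : Sph d)
    (W : Submodule ℝ (EuclideanSpace ℝ (Fin d))) :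
    (sphAct A x : EuclideanSpace ℝ (Fin d)) ∈ W ↔
      (x : EuclideanSpace ℝ (Fin d)) ∈ W.map (slEquiv A).symm.toLinearMap := by
  have h : (x : EuclideanSpace ℝ (Fin d)) ∈ W.map (slEquiv A).symm.toLinearMap ↔
      slVec A (x : EuclideanSpace ℝ (Fin d)) ∈ W := Submodule.mem_map_equiv W
  rw [h]
  exact W.smul_mem_iff (inv_ne_zero (norm_slVec_pos A x).ne')

theorem subMass_convSph {d : ℕ} (μ : ProbabilityMeasure (SL d)) (ν : ProbabilityMeasure (Sph d))
    (W : Submodule ℝ (EuclideanSpace ℝ (Fin d))) :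
    subMass (convSph μ ν) W =
      ∫⁻ A, subMass ν (W.map (slEquiv A).symm.toLinearMap) ∂(μ : Measure (SL d)) := by
  rw [subMass, convSph_apply _ _ (measurableSet_coe_mem W)]
  congr 1 with A
  rw [subMass]
  congr 1
  ext x
  exact sphAct_mem_iff A x W

theorem finrank_map_slEquiv_symm {d : ℕ} (A : SL d)
    (W : Submodule ℝ (EuclideanSpace ℝ (Fin d))) :
    Module.finrank ℝ (W.map (slEquiv A).symm.toLinearMap) = Module.finrank ℝ W :=
  LinearEquiv.finrank_map_eq _ _

/-- The subspaces of dimension `j` with mass `c`. -/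
def heavySubspaces {d : ℕ} (j : ℕ) (c : ℝ≥0∞) (ν : ProbabilityMeasure (Sph d)) :
    Set (Submodule ℝ (EuclideanSpace ℝ (Fin d))) :=
  {W | Module.finrank ℝ W = j ∧ subMass ν W = c}

theorem card_mul_le_one_of_subset_heavySubspaces {d j : ℕ} {c : ℝ≥0∞}
    {ν : ProbabilityMeasure (Sph d)}
    (hsmall : ∀ W : Submodule ℝ (EuclideanSpace ℝ (Fin d)), Module.finrank ℝ W < j →
      subMass ν W = 0)
    (t : Finset (Submodule ℝ (EuclideanSpace ℝ (Fin d))))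
    (ht : (t : Set (Submodule ℝ (EuclideanSpace ℝ (Fin d)))) ⊆ heavySubspaces j c ν) :
    t.card * c ≤ 1 := by
  have hdisj : Set.Pairwise (t : Set (Submodule ℝ (EuclideanSpace ℝ (Fin d))))
      (Function.onFun (AEDisjoint (ν : Measure (Sph d)))
        fun W => {x : Sph d | (x : EuclideanSpace ℝ (Fin d)) ∈ W}) := by
    intro W hW W' hW' hne
    have hlt : W ⊓ W' < W := by
      refine inf_le_left.lt_of_ne fun h => hne ?_
      exact Submodule.eq_of_le_of_finrank_eq (inf_eq_left.1 h) ((ht hW).1.trans (ht hW').1.symm)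
    exact hsmall _ ((Submodule.finrank_lt_finrank_of_lt hlt).trans_eq (ht hW).1)
  have h := measure_biUnion_finset₀ hdisj
    (fun W _ => (measurableSet_coe_mem W).nullMeasurableSet)
  calc (t.card : ℝ≥0∞) * c = ∑ W ∈ t, (ν : Measure (Sph d))
          {x : Sph d | (x : EuclideanSpace ℝ (Fin d)) ∈ W} := by
        refine Eq.trans ?_ (Finset.sum_congr rfl fun W hW => (ht hW).2.symm)
        rw [Finset.sum_const, nsmul_eq_mul]
    _ ≤ 1 := h ▸ prob_le_one

theorem finite_heavySubspaces {d j : ℕ} {c : ℝ≥0∞} (hc : c ≠ 0)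
    {ν : ProbabilityMeasure (Sph d)}
    (hsmall : ∀ W : Submodule ℝ (EuclideanSpace ℝ (Fin d)), Module.finrank ℝ W < j →
      subMass ν W = 0) :
    (heavySubspaces j c ν).Finite ∧ (heavySubspaces j c ν).ncard ≤ ⌊(c⁻¹).toReal⌋₊ := by
  have key : ∀ t : Finset (Submodule ℝ (EuclideanSpace ℝ (Fin d))),
      (t : Set (Submodule ℝ (EuclideanSpace ℝ (Fin d)))) ⊆ heavySubspaces j c ν →
        t.card ≤ ⌊(c⁻¹).toReal⌋₊ := by
    intro t ht
    apply Nat.le_floor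
    have h := ENNReal.le_inv_iff_mul_le.2 (card_mul_le_one_of_subset_heavySubspaces hsmall t ht)
    simpa using ENNReal.toReal_mono (ENNReal.inv_ne_top.2 hc) h
  have hfin : (heavySubspaces j c ν).Finite := by
    by_contra hinf
    obtain ⟨t, ht, hcard⟩ := Set.Infinite.exists_subset_card_eq hinf (⌊(c⁻¹).toReal⌋₊ + 1)
    have := key t ht
    omega
  refine ⟨hfin, ?_⟩
  rw [Set.ncard_eq_toFinset_card _ hfin]
  exact key _ (by simp)

/-- The spaces condition is incompatible with a finite family of proper subspaces being mapped
almost surely to a fixed family. -/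
theorem SpacesCondition.not_ae_image_eq {d : ℕ} {μ : ProbabilityMeasure (SL d)}
    (hμ : SpacesCondition μ) {F F' : Set (Submodule ℝ (EuclideanSpace ℝ (Fin d)))}
    (hF : F.Finite) (hne : F.Nonempty) (hF' : F'.Finite) (hne' : F'.Nonempty)
    (hproper : ∀ W ∈ F, W ≠ ⊥ ∧ W ≠ ⊤) (hproper' : ∀ W ∈ F', W ≠ ⊥ ∧ W ≠ ⊤)
    (h : ∀ᵐ A ∂(μ : Measure (SL d)),
      (fun W : Submodule ℝ (EuclideanSpace ℝ (Fin d)) =>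
        W.map (slEquiv A).symm.toLinearMap) '' F' = F) : False := by
  let e := WithLp.linearEquiv 2 ℝ (Fin d → ℝ)
  have hunion : ∀ G : Set (Submodule ℝ (EuclideanSpace ℝ (Fin d))), G.Finite → G.Nonempty →
      (∀ W ∈ G, W ≠ ⊥ ∧ W ≠ ⊤) →
      IsFiniteUnionOfProperSubspaces {v : Fin d → ℝ | ∃ W ∈ G, e.symm v ∈ W} := by
    intro G hG hGne hGp
    refine ⟨(fun W => W.map e.toLinearMap) '' G, hG.image _, hGne.image _, ?_, ?_⟩
    · rintro _ ⟨W, hW, rfl⟩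
      refine ⟨fun h0 => (hGp W hW).1 ?_, fun h0 => (hGp W hW).2 ?_⟩
      · exact (Submodule.map_eq_bot_iff (e := e)).1 h0
      · exact (Submodule.map_eq_top_iff (e := e)).1 h0
    · ext v
      simp only [Set.mem_ofPred_eq, Set.mem_iUnion, Set.mem_image, exists_prop,
        exists_exists_and_eq_and, SetLike.mem_coe]
      exact exists_congr fun W => and_congr_right fun _ =>
        (Submodule.mem_map_equiv W (e := e)).symm
  refine hμ ⟨_, _, hunion F hF hne hproper, hunion F' hF' hne' hproper', ?_⟩
  filter_upwards [h] with A hA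
  have hmem : ∀ (W : Submodule ℝ (EuclideanSpace ℝ (Fin d))) (x : EuclideanSpace ℝ (Fin d)),
      x ∈ W.map (slEquiv A).symm.toLinearMap ↔ slVec A x ∈ W := fun W x =>
    Submodule.mem_map_equiv W
  have hact : ∀ v : Fin d → ℝ,
      e.symm (Matrix.toLin' (A : Matrix (Fin d) (Fin d) ℝ) v) = slVec A (e.symm v) := fun v => rfl
  ext v
  simp only [Set.mem_image, Set.mem_ofPred_eq]
  constructor
  · rintro ⟨w, ⟨W, hW, hwW⟩, rfl⟩
    rw [← hA] at hW
    obtain ⟨W', hW', rfl⟩ := hW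
    exact ⟨W', hW', by rw [hact]; exact (hmem _ _).1 hwW⟩
  · rintro ⟨W', hW', hvW⟩
    obtain ⟨x, hx⟩ := (slEquiv A).surjective (e.symm v)
    change slVec A x = e.symm v at hx
    refine ⟨e x, ⟨_, hA ▸ Set.mem_image_of_mem _ hW', ?_⟩, ?_⟩
    · rw [LinearEquiv.symm_apply_apply, hmem, hx]
      exact hvW
    · apply e.symm.injective
      rw [hact, LinearEquiv.symm_apply_apply, hx]

/-- The heavy subspaces of `μ * ν` are almost surely pulled back to heavy subspaces of `ν`, when
`ν` has no heavier subspaces. -/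
theorem ae_image_heavySubspaces_subset {d j : ℕ} {c : ℝ≥0∞} (hc : c ≠ ⊤)
    {μ : ProbabilityMeasure (SL d)} {ν : ProbabilityMeasure (Sph d)}
    (hmax : ∀ W : Submodule ℝ (EuclideanSpace ℝ (Fin d)), Module.finrank ℝ W = j →
      subMass ν W ≤ c)
    (hfin : (heavySubspaces j c (convSph μ ν)).Finite) :
    ∀ᵐ A ∂(μ : Measure (SL d)),
      (fun W : Submodule ℝ (EuclideanSpace ℝ (Fin d)) =>
        W.map (slEquiv A).symm.toLinearMap) '' heavySubspaces j c (convSph μ ν) ⊆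
          heavySubspaces j c ν := by
  have h : ∀ᵐ A ∂(μ : Measure (SL d)), ∀ W ∈ heavySubspaces j c (convSph μ ν),
      subMass ν (W.map (slEquiv A).symm.toLinearMap) = c := by
    rw [ae_ball_iff hfin.countable]
    rintro W ⟨hWj, hWc⟩
    rw [subMass_convSph] at hWc
    refine ae_eq_of_ae_le_of_lintegral_le (μ := (μ : Measure (SL d))) (g := fun _ => c)
      (ae_of_all _ fun A => hmax _ ?_) ?_ aemeasurable_const ?_
    · rw [finrank_map_slEquiv_symm, hWj]
    · rwa [hWc]
    · simp [hWc]
  filter_upwards [h] with A hA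
  rintro _ ⟨W, hW, rfl⟩
  exact ⟨(finrank_map_slEquiv_symm A W).trans hW.1, hA W hW⟩

/-- In a compact family of laws where each one has a predecessor, no law charges a proper
subspace. -/
theorem subMass_eq_zero_of_forall_exists_convSph {d : ℕ} {K : Set (ProbabilityMeasure (SL d))}
    (hsp : ∀ μ ∈ K, SpacesCondition μ) {S : Set (ProbabilityMeasure (Sph d))} (hS : IsCompact S)
    (hpred : ∀ ν ∈ S, ∃ μ ∈ K, ∃ ν' ∈ S, convSph μ ν' = ν) {ν : ProbabilityMeasure (Sph d)}
    (hν : ν ∈ S) {W : Submodule ℝ (EuclideanSpace ℝ (Fin d))} (hW : W ≠ ⊤) :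
    subMass ν W = 0 := by
  classical
  by_contra hpos
  have hex : ∃ j, ∃ ν ∈ S, ∃ W : Submodule ℝ (EuclideanSpace ℝ (Fin d)),
      Module.finrank ℝ W = j ∧ subMass ν W ≠ 0 := ⟨_, ν, hν, W, rfl, hpos⟩
  set j := Nat.find hex with hj
  have hjd : j < d := by
    have h1 := Submodule.finrank_lt hW
    rw [finrank_euclideanSpace_fin] at h1
    exact (Nat.find_le ⟨ν, hν, W, rfl, hpos⟩).trans_lt h1
  have hsmall : ∀ ν ∈ S, ∀ W : Submodule ℝ (EuclideanSpace ℝ (Fin d)),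
      Module.finrank ℝ W < j → subMass ν W = 0 := by
    intro ν hν W hWj
    by_contra h
    exact Nat.find_min hex hWj ⟨ν, hν, W, rfl, h⟩
  obtain ⟨ν₁, hν₁, W₁, hW₁j, hW₁⟩ := Nat.find_spec hex
  rw [← hj] at hW₁j
  have hjpos : j ≠ 0 := by
    intro h0
    rw [h0] at hW₁j
    rw [Submodule.finrank_eq_zero] at hW₁j
    apply hW₁
    rw [hW₁j, subMass]
    convert measure_empty (μ := (ν₁ : Measure (Sph d)))
    ext x
    simp [Sph.coe_ne_zero x]
  obtain ⟨ν₀, hν₀, W₀, hW₀j, hmax⟩ := exists_forall_subMass_le hjd.le hS ⟨ν, hν⟩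
  set c := subMass ν₀ W₀ with hc
  have hc0 : c ≠ 0 := fun h => hW₁ (le_zero_iff.1 (h ▸ hmax ν₁ hν₁ W₁ hW₁j))
  have hctop : c ≠ ⊤ := measure_ne_top _ _
  have hfin : ∀ ν ∈ S, (heavySubspaces j c ν).Finite := fun ν hν =>
    (finite_heavySubspaces hc0 (hsmall ν hν)).1
  have hproper : ∀ ν : ProbabilityMeasure (Sph d), ∀ V ∈ heavySubspaces j c ν, V ≠ ⊥ ∧ V ≠ ⊤ := by
    rintro ν V ⟨hVj, -⟩
    constructor
    · rintro rfl
      exact hjpos (by rw [← hVj, finrank_bot])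
    · rintro rfl
      rw [finrank_top, finrank_euclideanSpace_fin] at hVj
      omega
  let N : Set ℕ := {n | ∃ ν ∈ S, (heavySubspaces j c ν).ncard = n}
  have hNbdd : BddAbove N := by
    refine ⟨⌊(c⁻¹).toReal⌋₊, ?_⟩
    rintro _ ⟨ν, hν, rfl⟩
    exact (finite_heavySubspaces hc0 (hsmall ν hν)).2
  obtain ⟨ν₂, hν₂, hcard⟩ := Nat.sSup_mem (s := N) ⟨_, ν₀, hν₀, rfl⟩ hNbdd
  have hle : ∀ ν ∈ S, (heavySubspaces j c ν).ncard ≤ (heavySubspaces j c ν₂).ncard :=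
    fun ν hν => hcard ▸ le_csSup hNbdd ⟨ν, hν, rfl⟩
  have hne₂ : (heavySubspaces j c ν₂).Nonempty := by
    rw [← Set.ncard_pos (hfin ν₂ hν₂)]
    refine lt_of_lt_of_le ?_ (hle ν₀ hν₀)
    rw [Set.ncard_pos (hfin ν₀ hν₀)]
    exact ⟨W₀, hW₀j, rfl⟩
  obtain ⟨μ, hμ, ν₃, hν₃, rfl⟩ := hpred ν₂ hν₂
  have hinj : ∀ A : SL d, Function.Injective
      (fun W : Submodule ℝ (EuclideanSpace ℝ (Fin d)) => W.map (slEquiv A).symm.toLinearMap) :=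
    fun A => Submodule.map_injective_of_injective (slEquiv A).symm.injective
  have hae : ∀ᵐ A ∂(μ : Measure (SL d)),
      (fun W : Submodule ℝ (EuclideanSpace ℝ (Fin d)) =>
        W.map (slEquiv A).symm.toLinearMap) '' heavySubspaces j c (convSph μ ν₃) =
          heavySubspaces j c ν₃ := by
    filter_upwards [ae_image_heavySubspaces_subset hctop (fun W hW => hmax ν₃ hν₃ W hW)
      (hfin _ hν₂)] with A hA
    refine Set.eq_of_subset_of_ncard_le hA ?_ (hfin _ hν₃)
    rw [Set.ncard_image_of_injective _ (hinj A)]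
    exact hle ν₃ hν₃
  have hne₃ : (heavySubspaces j c ν₃).Nonempty := by
    obtain ⟨A, hA⟩ := hae.exists
    exact hA ▸ hne₂.image _
  exact (hsp μ hμ).not_ae_image_eq (hfin _ hν₃) hne₃ (hfin _ hν₂) hne₂ (hproper _) (hproper _) hae

/-- After sufficiently many steps, the laws are uniformly spread away from hyperplanes. -/
theorem exists_forall_reach_measure_abs_inner_le {d : ℕ}
    {K : Set (ProbabilityMeasure (SL d))} (hK : IsCompact K) (hsp : ∀ μ ∈ K, SpacesCondition μ)
    {ε : ℝ≥0∞} (hε : ε ≠ 0) :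
    ∃ n : ℕ, ∃ η : ℝ, 0 < η ∧ ∀ ν ∈ reach K n, ∀ u : Sph d,
      (ν : Measure (Sph d)) {x | |inner ℝ (u : EuclideanSpace ℝ (Fin d)) x| ≤ η} ≤ ε := by
  by_contra! hcon
  let F : ℕ → Set (Sph d × Sph d) := fun n =>
    {p | |inner ℝ (p.1 : EuclideanSpace ℝ (Fin d)) p.2| ≤ 1 / ((n : ℝ) + 1)}
  have hcont : Continuous fun p : Sph d × Sph d =>
      |inner ℝ (p.1 : EuclideanSpace ℝ (Fin d)) (p.2 : EuclideanSpace ℝ (Fin d))| :=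
    ((continuous_subtype_val.comp continuous_fst).inner
      (continuous_subtype_val.comp continuous_snd)).abs
  have hF : ∀ n, IsClosed (F n) := fun n => isClosed_le hcont continuous_const
  have hFanti : ∀ n, F (n + 1) ⊆ F n := fun n p hp => by
    simp only [F, Set.mem_ofPred_eq] at hp ⊢
    exact hp.trans (Nat.one_div_le_one_div n.le_succ)
  let Z : ℕ → Set (ProbabilityMeasure (Sph d) × Sph d) := fun n =>
    (reach K n ×ˢ Set.univ) ∩ {p | ε ≤ (p.1 : Measure (Sph d)) (Prod.mk p.2 ⁻¹' F n)}
  have hZ : ∀ n, IsCompact (Z n) := by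
    intro n
    refine ((isCompact_reach hK n).prod isCompact_univ).inter_right ?_
    exact (upperSemicontinuous_measure_section (hF n)).isClosed_preimage ε
  obtain ⟨p, hp⟩ := IsCompact.nonempty_iInter_of_sequence_nonempty_isCompact_isClosed Z
    (fun n => Set.inter_subset_inter (Set.prod_mono_left (reach_succ_subset K n))
      fun p hp => le_trans (show _ ≤ _ from hp) (measure_mono (Set.preimage_mono (hFanti n))))
    (fun n => by
      obtain ⟨ν, hν, u, hu⟩ := hcon n (1 / ((n : ℝ) + 1)) Nat.one_div_pos_of_nat
      exact ⟨(ν, u), ⟨hν, Set.mem_univ _⟩, hu.le⟩)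
    (hZ 0) (fun n => (hZ n).isClosed)
  rw [Set.mem_iInter] at hp
  have hmem : p.1 ∈ ⋂ n, reach K n := Set.mem_iInter.2 fun n => (hp n).1.1
  let W : Submodule ℝ (EuclideanSpace ℝ (Fin d)) :=
    (Submodule.span ℝ {(p.2 : EuclideanSpace ℝ (Fin d))})ᗮ
  have hW : W ≠ ⊤ := by
    intro h
    have h1 : (p.2 : EuclideanSpace ℝ (Fin d)) ∈ W := h ▸ Submodule.mem_top
    rw [Submodule.mem_orthogonal_singleton_iff_inner_right, inner_self_eq_zero] at h1
    exact Sph.coe_ne_zero _ h1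
  have hScomp : IsCompact (⋂ n, reach K n) :=
    (isCompact_reach hK 0).of_isClosed_subset
      (isClosed_iInter fun n => (isCompact_reach hK n).isClosed) (Set.iInter_subset _ 0)
  have hzero := subMass_eq_zero_of_forall_exists_convSph hsp hScomp
    (fun ν hν => exists_convSph_of_mem_iInter_reach hK hν) hmem hW
  have hanti : Antitone fun n => Prod.mk p.2 ⁻¹' F n :=
    antitone_nat_of_succ_le fun n => Set.preimage_mono (hFanti n)
  have hlim := tendsto_measure_iInter_atTop (μ := (p.1 : Measure (Sph d)))
    (s := fun n => Prod.mk p.2 ⁻¹' F n)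
    (fun n => ((hF n).preimage (Continuous.prodMk_right p.2)).measurableSet.nullMeasurableSet)
    hanti ⟨0, measure_ne_top _ _⟩
  have hset : ⋂ n, Prod.mk p.2 ⁻¹' F n = {x : Sph d | (x : EuclideanSpace ℝ (Fin d)) ∈ W} := by
    ext x
    have hx : (x : EuclideanSpace ℝ (Fin d)) ∈ W ↔
        inner ℝ (p.2 : EuclideanSpace ℝ (Fin d)) (x : EuclideanSpace ℝ (Fin d)) = 0 :=
      Submodule.mem_orthogonal_singleton_iff_inner_right
    rw [Set.mem_ofPred_eq, hx, Set.mem_iInter]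
    constructor
    · intro h
      simp only [F, Set.mem_preimage, Set.mem_ofPred_eq] at h
      exact abs_nonpos_iff.1 (ge_of_tendsto' tendsto_one_div_add_atTop_nhds_zero_nat h)
    · intro h n
      change |inner ℝ (p.2 : EuclideanSpace ℝ (Fin d)) (x : EuclideanSpace ℝ (Fin d))| ≤ _
      rw [h, abs_zero]
      exact Nat.one_div_pos_of_nat.le
  rw [hset] at hlim
  have : ε ≤ subMass p.1 W := ge_of_tendsto' hlim fun n => (hp n).2
  rw [hzero] at this
  exact hε (le_zero_iff.1 this)

/-- The law of `A_n ⋯ A_2 A_1`, for independent `A_{i+1}` with law `μ i`. -/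
def prodLaw {d : ℕ} (μ : ℕ → ProbabilityMeasure (SL d)) : ℕ → Measure (SL d)
  | 0 => Measure.dirac 1
  | n + 1 => (μ n : Measure (SL d)).mconv (prodLaw μ n)

instance isProbabilityMeasure_prodLaw {d : ℕ} (μ : ℕ → ProbabilityMeasure (SL d)) (n : ℕ) :
    IsProbabilityMeasure (prodLaw μ n) := by
  induction n with
  | zero => exact Measure.dirac.isProbabilityMeasure
  | succ n ih => exact Measure.probabilitymeasure_of_probabilitymeasures_mconv _ _

theorem prodLaw_add {d : ℕ} (μ : ℕ → ProbabilityMeasure (SL d)) (n i : ℕ) :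
    prodLaw μ (n + i) = (prodLaw (fun j => μ (n + j)) i).mconv (prodLaw μ n) := by
  induction i with
  | zero => exact (Measure.dirac_one_mconv _).symm
  | succ i ih =>
    rw [← add_assoc, prodLaw, ih, prodLaw, Measure.mconv_assoc]

theorem measurable_sphAct_comp {X : Type*} [MeasurableSpace X] {d : ℕ} {f : X → SL d}
    {g : X → Sph d} (hf : Measurable f) (hg : Measurable g) :
    Measurable fun x => sphAct (f x) (g x) := by
  have h := (continuous_sphAct d).measurable.comp (hf.prodMk hg)
  simpa only [Function.comp_def] using h

theorem measurable_sphAct_left {d : ℕ} (x : Sph d) : Measurable fun A : SL d => sphAct A x :=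
  measurable_sphAct_comp measurable_id measurable_const

theorem measurable_slDefect_comp {X : Type*} [MeasurableSpace X] {d : ℕ} (hd : 0 < d)
    {f : X → SL d} {g : X → Sph d} (hf : Measurable f) (hg : Measurable g) :
    Measurable fun x => slDefect (f x) (g x) := by
  have h := (continuous_slDefect hd).measurable.comp (hf.prodMk hg)
  simpa only [Function.comp_def] using h

theorem measurable_slDefect_left {d : ℕ} (hd : 0 < d) (x : Sph d) :
    Measurable fun A : SL d => slDefect A x :=
  measurable_slDefect_comp hd measurable_id measurable_const

theorem measurable_slCond (d : ℕ) : Measurable (slCond : SL d → ℝ) :=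
  (continuous_slCond d).measurable

theorem exists_mem_reach_eq_map_prodLaw {d : ℕ} {K : Set (ProbabilityMeasure (SL d))}
    {μ : ℕ → ProbabilityMeasure (SL d)} (hμ : ∀ i, μ i ∈ K) (x : Sph d) (n : ℕ) :
    ∃ ν ∈ reach K n, (ν : Measure (Sph d)) = (prodLaw μ n).map fun A => sphAct A x := by
  induction n with
  | zero =>
    exact ⟨⟨_, Measure.isProbabilityMeasure_map (measurable_sphAct_left x).aemeasurable⟩,
      Set.mem_univ _, rfl⟩
  | succ n ih =>
    obtain ⟨ν, hν, hνeq⟩ := ih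
    refine ⟨convSph (μ n) ν, Set.mem_image2_of_mem (hμ n) hν, ?_⟩
    have hA : ∀ A : SL d, Measurable fun y : Sph d => sphAct A y := fun A =>
      ((continuous_sphAct d).comp (Continuous.prodMk_right A)).measurable
    refine Measure.ext_of_lintegral _ fun f hf => ?_
    have hf2 : Measurable fun p : SL d × Sph d => f (sphAct p.1 p.2) :=
      hf.comp (continuous_sphAct d).measurable
    rw [toMeasure_convSph, lintegral_map hf (continuous_sphAct d).measurable,
      lintegral_prod _ hf2.aemeasurable, lintegral_map hf (measurable_sphAct_left x), prodLaw,
      Measure.lintegral_mconv (f := fun A => f (sphAct A x))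
        (hf.comp (measurable_sphAct_left x))]
    refine lintegral_congr fun A => ?_
    rw [hνeq, lintegral_map (f := fun y => f (sphAct A y)) (hf.comp (hA A))
      (measurable_sphAct_left x)]
    simp only [sphAct_mul]

theorem lintegral_slCond_rpow_prodLaw_le {d : ℕ} {β M : ℝ} (hβ : 0 < β)
    {μ : ℕ → ProbabilityMeasure (SL d)}
    (hM : ∀ i, ∫⁻ A, ENNReal.ofReal (slCond A ^ β) ∂(μ i : Measure (SL d)) ≤ ENNReal.ofReal M)
    (n : ℕ) :
    ∫⁻ A, ENNReal.ofReal (slCond A ^ β) ∂(prodLaw μ n) ≤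
      ENNReal.ofReal (slCond (1 : SL d) ^ β) * ENNReal.ofReal M ^ n := by
  have hmeas : Measurable fun A : SL d => ENNReal.ofReal (slCond A ^ β) :=
    ((measurable_slCond d).pow_const β).ennreal_ofReal
  have hnn : ∀ A : SL d, 0 ≤ slCond A := fun A => mul_nonneg (slNorm_nonneg _) (slNorm_nonneg _)
  induction n with
  | zero => simp [prodLaw, lintegral_dirac' _ hmeas]
  | succ n ih =>
    rw [prodLaw, Measure.lintegral_mconv hmeas]
    calc ∫⁻ A, ∫⁻ B, ENNReal.ofReal (slCond (A * B) ^ β) ∂(prodLaw μ n) ∂(μ n : Measure (SL d))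
        ≤ ∫⁻ A, ENNReal.ofReal (slCond A ^ β) * (ENNReal.ofReal (slCond (1 : SL d) ^ β) *
            ENNReal.ofReal M ^ n) ∂(μ n : Measure (SL d)) := by
          refine lintegral_mono fun A => ?_
          calc ∫⁻ B, ENNReal.ofReal (slCond (A * B) ^ β) ∂(prodLaw μ n)
              ≤ ∫⁻ B, ENNReal.ofReal (slCond A ^ β) * ENNReal.ofReal (slCond B ^ β)
                  ∂(prodLaw μ n) := by
                refine lintegral_mono fun B => ?_
                rw [← ENNReal.ofReal_mul (Real.rpow_nonneg (hnn A) β),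
                  ← Real.mul_rpow (hnn A) (hnn B)]
                exact ENNReal.ofReal_le_ofReal
                  (Real.rpow_le_rpow (hnn _) (slCond_mul_le A B) hβ.le)
            _ ≤ _ := by
                rw [lintegral_const_mul _ hmeas]
                gcongr
      _ ≤ _ := by
          rw [lintegral_mul_const _ hmeas]
          calc _ ≤ ENNReal.ofReal M * (ENNReal.ofReal (slCond (1 : SL d) ^ β) *
                ENNReal.ofReal M ^ n) := by gcongr; exact hM n
            _ = _ := by ring

theorem slCond_one {d : ℕ} (hd : 0 < d) : slCond (1 : SL d) = 1 := by
  obtain ⟨x⟩ := nonempty_Sph hd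
  have h : slNorm (1 : SL d) ≤ 1 := by
    rw [slNorm, opNorm, Matrix.SpecialLinearGroup.coe_one, map_one]
    exact ContinuousLinearMap.norm_id_le
  refine le_antisymm ?_ (one_le_slCond hd 1)
  rw [slCond, inv_one]
  exact mul_le_one₀ h (slNorm_nonneg _) h

theorem lintegral_log_slCond_prodLaw_le {d : ℕ} (hd : 0 < d) {c : ℝ≥0∞}
    {μ : ℕ → ProbabilityMeasure (SL d)}
    (hc : ∀ i, ∫⁻ A, ENNReal.ofReal (Real.log (slCond A)) ∂(μ i : Measure (SL d)) ≤ c) (n : ℕ) :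
    ∫⁻ A, ENNReal.ofReal (Real.log (slCond A)) ∂(prodLaw μ n) ≤ n * c := by
  have hmeas : Measurable fun A : SL d => ENNReal.ofReal (Real.log (slCond A)) :=
    (measurable_slCond d).log.ennreal_ofReal
  have hpos : ∀ A : SL d, 0 < slCond A := fun A => zero_lt_one.trans_le (one_le_slCond hd A)
  induction n with
  | zero => simp [prodLaw, lintegral_dirac' _ hmeas, slCond_one hd]
  | succ n ih =>
    rw [prodLaw, Measure.lintegral_mconv hmeas]
    calc ∫⁻ A, ∫⁻ B, ENNReal.ofReal (Real.log (slCond (A * B))) ∂(prodLaw μ n)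
            ∂(μ n : Measure (SL d))
        ≤ ∫⁻ A, ∫⁻ B, (ENNReal.ofReal (Real.log (slCond A)) +
            ENNReal.ofReal (Real.log (slCond B))) ∂(prodLaw μ n) ∂(μ n : Measure (SL d)) := by
          refine lintegral_mono fun A => lintegral_mono fun B => ?_
          refine le_trans (ENNReal.ofReal_le_ofReal ?_) ENNReal.ofReal_add_le
          rw [← Real.log_mul (hpos A).ne' (hpos B).ne']
          exact Real.log_le_log (hpos _) (slCond_mul_le A B)
      _ = ∫⁻ A, ENNReal.ofReal (Real.log (slCond A)) ∂(μ n : Measure (SL d)) +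
            ∫⁻ B, ENNReal.ofReal (Real.log (slCond B)) ∂(prodLaw μ n) := by
          simp [lintegral_add_left measurable_const, lintegral_add_left hmeas]
      _ ≤ c + n * c := add_le_add (hc n) ih
      _ = _ := by push_cast; ring

/-- If the laws after `n` steps are spread away from hyperplanes, the expected cancellation of a
longer product is small. -/
theorem lintegral_slDefect_prodLaw_le {d : ℕ} (hd : 0 < d) {K : Set (ProbabilityMeasure (SL d))}
    {c ε : ℝ≥0∞} {η : ℝ} (hη : 0 < η) {n : ℕ}
    (hspread : ∀ ν ∈ reach K n, ∀ u : Sph d,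
      (ν : Measure (Sph d)) {x | |inner ℝ (u : EuclideanSpace ℝ (Fin d)) x| ≤ η} ≤ ε)
    {μ : ℕ → ProbabilityMeasure (SL d)} (hμ : ∀ i, μ i ∈ K)
    (hc : ∀ i, ∫⁻ A, ENNReal.ofReal (Real.log (slCond A)) ∂(μ i : Measure (SL d)) ≤ c)
    (x : Sph d) (i : ℕ) :
    ∫⁻ A, ENNReal.ofReal (slDefect A x) ∂(prodLaw μ (n + i)) ≤
      n * c + (ENNReal.ofReal (-Real.log η) + i * c * ε) := by
  have hdefx := (measurable_slDefect_left hd x).ennreal_ofReal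
  have hlog : Measurable fun A : SL d => ENNReal.ofReal (Real.log (slCond A)) :=
    (measurable_slCond d).log.ennreal_ofReal
  rw [prodLaw_add, Measure.lintegral_mconv hdefx]
  have hfix : ∀ A : SL d, ∫⁻ B, ENNReal.ofReal (slDefect A (sphAct B x)) ∂(prodLaw μ n) ≤
      ENNReal.ofReal (-Real.log η) + ENNReal.ofReal (Real.log (slCond A)) * ε := by
    intro A
    obtain ⟨ν, hν, hνeq⟩ := exists_mem_reach_eq_map_prodLaw hμ x n
    obtain ⟨u, hu⟩ := exists_slDefect_le_neg_log_abs_inner hd A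
    have hdefA : Measurable fun y : Sph d => ENNReal.ofReal (slDefect A y) :=
      (measurable_slDefect_comp hd measurable_const measurable_id).ennreal_ofReal
    have hset : MeasurableSet
        {y : Sph d | |inner ℝ (u : EuclideanSpace ℝ (Fin d)) (y : EuclideanSpace ℝ (Fin d))| ≤ η} :=
      (isClosed_le (continuous_const.inner continuous_subtype_val).abs
        continuous_const).measurableSet
    rw [← lintegral_map hdefA (measurable_sphAct_left x), ← hνeq]
    calc ∫⁻ y, ENNReal.ofReal (slDefect A y) ∂(ν : Measure (Sph d))
        ≤ ∫⁻ y, (ENNReal.ofReal (-Real.log η) +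
            Set.indicator {y : Sph d | |inner ℝ (u : EuclideanSpace ℝ (Fin d))
              (y : EuclideanSpace ℝ (Fin d))| ≤ η}
              (fun _ => ENNReal.ofReal (Real.log (slCond A))) y) ∂(ν : Measure (Sph d)) := by
          refine lintegral_mono fun y => ?_
          by_cases hy : |inner ℝ (u : EuclideanSpace ℝ (Fin d))
              (y : EuclideanSpace ℝ (Fin d))| ≤ η
          · rw [Set.indicator_of_mem (by exact hy)]
            exact le_add_left (ENNReal.ofReal_le_ofReal (slDefect_le_log_slCond hd A y))
          · exact le_add_right (ENNReal.ofReal_le_ofReal (hu y η hη (not_le.1 hy).le))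
      _ ≤ _ := by
          rw [lintegral_add_left measurable_const, lintegral_indicator_const hset]
          simp only [measure_univ, lintegral_const, mul_one]
          gcongr
          exact hspread ν hν u
  calc ∫⁻ A, ∫⁻ B, ENNReal.ofReal (slDefect (A * B) x) ∂(prodLaw μ n)
          ∂(prodLaw (fun j => μ (n + j)) i)
      ≤ ∫⁻ A, (n * c + (ENNReal.ofReal (-Real.log η) +
          ENNReal.ofReal (Real.log (slCond A)) * ε)) ∂(prodLaw (fun j => μ (n + j)) i) := by
        refine lintegral_mono fun A => ?_
        calc ∫⁻ B, ENNReal.ofReal (slDefect (A * B) x) ∂(prodLaw μ n)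
            ≤ ∫⁻ B, (ENNReal.ofReal (slDefect B x) +
                ENNReal.ofReal (slDefect A (sphAct B x))) ∂(prodLaw μ n) :=
              lintegral_mono fun B => (ENNReal.ofReal_le_ofReal (slDefect_mul_le hd A B x)).trans
                ENNReal.ofReal_add_le
          _ ≤ _ := by
              rw [lintegral_add_left hdefx]
              refine add_le_add (le_trans (lintegral_mono fun B => ?_)
                (lintegral_log_slCond_prodLaw_le hd hc n)) (hfix A)
              exact ENNReal.ofReal_le_ofReal (slDefect_le_log_slCond hd B x)
    _ = n * c + (ENNReal.ofReal (-Real.log η) +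
          (∫⁻ A, ENNReal.ofReal (Real.log (slCond A)) ∂(prodLaw (fun j => μ (n + j)) i)) * ε) := by
        rw [lintegral_add_left measurable_const, lintegral_add_left measurable_const,
          lintegral_mul_const _ hlog]
        simp
    _ ≤ _ := by
        gcongr
        exact lintegral_log_slCond_prodLaw_le hd (fun j => hc (n + j)) i

theorem exp_le_one_add_add_sq_mul_exp {x : ℝ} (hx : 0 ≤ x) :
    Real.exp x ≤ 1 + x + x ^ 2 * Real.exp x := by
  have h : Real.exp x * (1 - x) ≤ 1 := by
    have h1 := mul_le_mul_of_nonneg_left (Real.one_sub_le_exp_neg x) (Real.exp_pos x).le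
    rwa [← Real.exp_add, add_neg_cancel, Real.exp_zero] at h1
  nlinarith

theorem exp_mul_le_of_le_log {R κ s β : ℝ} (hR : 0 ≤ R) (hκ : 1 ≤ κ) (hRκ : R ≤ Real.log κ)
    (hs : 0 ≤ s) (hβ : 0 < β) (hsβ : s ≤ β / 2) :
    Real.exp (s * R) ≤ 1 + s * R + s ^ 2 * (16 / β ^ 2) * κ ^ β := by
  have h := exp_le_one_add_add_sq_mul_exp (mul_nonneg hs hR)
  have hκβ : Real.exp (β * R) ≤ κ ^ β := by
    rw [Real.rpow_def_of_pos (zero_lt_one.trans_le hκ)]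
    exact Real.exp_le_exp.2 (by nlinarith)
  have h1 : R ≤ 4 / β * Real.exp (β * R / 4) := by
    have := (le_add_of_nonneg_right zero_le_one).trans (Real.add_one_le_exp (β * R / 4))
    rw [div_mul_eq_mul_div, le_div_iff₀ hβ]
    linarith
  have h2 : R ^ 2 ≤ 16 / β ^ 2 * Real.exp (β * R / 2) := by
    calc R ^ 2 ≤ (4 / β * Real.exp (β * R / 4)) ^ 2 := pow_le_pow_left₀ hR h1 2
      _ = _ := by
        rw [mul_pow, ← Real.exp_nat_mul]
        ring_nf
  have h3 : Real.exp (s * R) ≤ Real.exp (β * R / 2) := Real.exp_le_exp.2 (by nlinarith)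
  have h4 : R ^ 2 * Real.exp (s * R) ≤ 16 / β ^ 2 * κ ^ β := by
    calc R ^ 2 * Real.exp (s * R)
        ≤ 16 / β ^ 2 * Real.exp (β * R / 2) * Real.exp (β * R / 2) :=
          mul_le_mul h2 h3 (Real.exp_pos _).le (by positivity)
      _ = 16 / β ^ 2 * Real.exp (β * R) := by
          rw [mul_assoc, ← Real.exp_add]
          ring_nf
      _ ≤ _ := by gcongr
  calc Real.exp (s * R) ≤ 1 + s * R + s ^ 2 * (R ^ 2 * Real.exp (s * R)) := by linarith
    _ ≤ 1 + s * R + s ^ 2 * (16 / β ^ 2 * κ ^ β) := by gcongr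
    _ = _ := by ring

/-- The expected cancellation of a long product is small compared to its length. -/
theorem exists_forall_lintegral_slDefect_prodLaw_le {d : ℕ} (hd : 0 < d)
    {K : Set (ProbabilityMeasure (SL d))} (hK : IsCompact K) (hsp : ∀ μ ∈ K, SpacesCondition μ)
    {c : ℝ} (hc0 : 0 < c)
    (hc : ∀ μ ∈ K, ∫⁻ A, ENNReal.ofReal (Real.log (slCond A)) ∂(μ : Measure (SL d)) ≤
      ENNReal.ofReal c) {ε : ℝ} (hε : 0 < ε) :
    ∃ k₁ : ℕ, ∀ k, k₁ < k → ∀ μ : ℕ → ProbabilityMeasure (SL d), (∀ i, μ i ∈ K) → ∀ x : Sph d,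
      ∫⁻ A, ENNReal.ofReal (slDefect A x) ∂(prodLaw μ k) ≤ ENNReal.ofReal (k * ε) := by
  have hε' : 0 < ε / (2 * c) := by positivity
  obtain ⟨n, η, hη, hspread⟩ := exists_forall_reach_measure_abs_inner_le hK hsp
    (ε := ENNReal.ofReal (ε / (2 * c))) (by simpa using hε')
  obtain ⟨N, hN⟩ := exists_nat_ge (2 * (n * c + max 0 (-Real.log η)) / ε)
  refine ⟨max n N, fun k hk μ hμ x => ?_⟩
  obtain ⟨i, rfl⟩ := Nat.exists_eq_add_of_le ((le_max_left n N).trans hk.le)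
  refine (lintegral_slDefect_prodLaw_le hd hη hspread hμ (fun j => hc _ (hμ j)) x i).trans ?_
  have hNk : (N : ℝ) ≤ (n + i : ℕ) := by exact_mod_cast (le_max_right n N).trans hk.le
  rw [← ENNReal.ofReal_natCast, ← ENNReal.ofReal_natCast, ← ENNReal.ofReal_mul (by positivity),
    ← ENNReal.ofReal_mul (by positivity), ← ENNReal.ofReal_mul (by positivity)]
  have hmax : ENNReal.ofReal (-Real.log η) = ENNReal.ofReal (max 0 (-Real.log η)) := by
    rw [max_comm, ENNReal.ofReal_max]
    simp
  rw [hmax, ← ENNReal.ofReal_add (le_max_left _ _) (by positivity),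
    ← ENNReal.ofReal_add (by positivity) (by positivity)]
  refine ENNReal.ofReal_le_ofReal ?_
  have h1 : 2 * (n * c + max 0 (-Real.log η)) ≤ (n + i : ℕ) * ε := by
    rw [div_le_iff₀ hε] at hN
    exact hN.trans (by gcongr)
  have h2 : (i : ℝ) * c * (ε / (2 * c)) ≤ (n + i : ℕ) * ε / 2 := by
    have : (i : ℝ) * c * (ε / (2 * c)) = i * ε / 2 := by field_simp
    rw [this]
    gcongr
    omega
  linarith

/-- Exponential moments of the cancellation of a long product. -/
theorem exists_forall_lintegral_exp_slDefect_prodLaw_le {d : ℕ} (hd : 0 < d)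
    {K : Set (ProbabilityMeasure (SL d))} (hK : IsCompact K) (hsp : ∀ μ ∈ K, SpacesCondition μ)
    {γ C : ℝ} (hγ : 0 < γ) (hmom : ∀ μ ∈ K, FiniteMomentCondition γ C μ) {ε : ℝ} (hε : 0 < ε) :
    ∃ k₁ : ℕ, ∀ k, k₁ < k → ∃ s : ℝ, 0 < s ∧
      ∀ μ : ℕ → ProbabilityMeasure (SL d), (∀ i, μ i ∈ K) → ∀ x : Sph d,
        ∫⁻ A, ENNReal.ofReal (Real.exp (s * slDefect A x)) ∂(prodLaw μ k) ≤
          ENNReal.ofReal (Real.exp (s * (k * ε))) := by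
  obtain ⟨β, hβ, M, hM1, hM⟩ := exists_lintegral_slCond_rpow_le hd hγ C
  have hc : ∀ μ ∈ K, ∫⁻ A, ENNReal.ofReal (Real.log (slCond A)) ∂(μ : Measure (SL d)) ≤
      ENNReal.ofReal (M / β) := by
    intro μ hμ
    calc ∫⁻ A, ENNReal.ofReal (Real.log (slCond A)) ∂(μ : Measure (SL d))
        ≤ ∫⁻ A, ENNReal.ofReal (slCond A ^ β) * ENNReal.ofReal β⁻¹ ∂(μ : Measure (SL d)) := by
          refine lintegral_mono fun A => ?_
          rw [← ENNReal.ofReal_mul' (inv_nonneg.2 hβ.le), ← div_eq_mul_inv]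
          exact ENNReal.ofReal_le_ofReal
            (Real.log_le_rpow_div (zero_le_one.trans (one_le_slCond hd A)) hβ)
      _ ≤ ENNReal.ofReal M * ENNReal.ofReal β⁻¹ := by
          rw [lintegral_mul_const _ ((measurable_slCond d).pow_const β).ennreal_ofReal]
          gcongr
          exact hM μ (hmom μ hμ)
      _ = ENNReal.ofReal (M / β) := by
          rw [← ENNReal.ofReal_mul' (inv_nonneg.2 hβ.le), ← div_eq_mul_inv]
  obtain ⟨k₁, hk₁⟩ := exists_forall_lintegral_slDefect_prodLaw_le hd hK hsp
    (div_pos (zero_lt_one.trans_le hM1) hβ) hc (half_pos hε)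
  refine ⟨k₁, fun k hk => ?_⟩
  have hkpos : (0 : ℝ) < k := by exact_mod_cast (Nat.zero_le k₁).trans_lt hk
  set D := 16 / β ^ 2 * M ^ k with hD
  have hDpos : 0 < D := by positivity
  set s := min (β / 2) (k * ε / (2 * D)) with hs
  have hspos : 0 < s := lt_min (by positivity) (by positivity)
  refine ⟨s, hspos, fun μ hμ x => ?_⟩
  have hdef := (measurable_slDefect_left hd x).ennreal_ofReal
  have hcond : Measurable fun A : SL d => ENNReal.ofReal (slCond A ^ β) :=
    ((measurable_slCond d).pow_const β).ennreal_ofReal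
  have hmoment := lintegral_slCond_rpow_prodLaw_le hβ (fun i => hM _ (hmom _ (hμ i))) k
  rw [slCond_one hd, Real.one_rpow, ENNReal.ofReal_one, one_mul,
    ← ENNReal.ofReal_pow (by positivity)] at hmoment
  calc ∫⁻ A, ENNReal.ofReal (Real.exp (s * slDefect A x)) ∂(prodLaw μ k)
      ≤ ∫⁻ A, (1 + (ENNReal.ofReal s * ENNReal.ofReal (slDefect A x) +
          ENNReal.ofReal (s ^ 2 * (16 / β ^ 2)) * ENNReal.ofReal (slCond A ^ β)))
          ∂(prodLaw μ k) := by
        refine lintegral_mono fun A => ?_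
        have hR := slDefect_nonneg A x
        have hκ := one_le_slCond hd A
        rw [← ENNReal.ofReal_one, ← ENNReal.ofReal_mul hspos.le,
          ← ENNReal.ofReal_mul (by positivity), ← ENNReal.ofReal_add (by positivity) (by positivity),
          ← ENNReal.ofReal_add (by positivity) (by positivity), ← add_assoc]
        exact ENNReal.ofReal_le_ofReal (exp_mul_le_of_le_log hR hκ (slDefect_le_log_slCond hd A x)
          hspos.le hβ (min_le_left _ _))
    _ = 1 + (ENNReal.ofReal s * ∫⁻ A, ENNReal.ofReal (slDefect A x) ∂(prodLaw μ k) +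
          ENNReal.ofReal (s ^ 2 * (16 / β ^ 2)) *
            ∫⁻ A, ENNReal.ofReal (slCond A ^ β) ∂(prodLaw μ k)) := by
        rw [lintegral_add_left measurable_const, lintegral_add_left (hdef.const_mul _),
          lintegral_const_mul _ hdef, lintegral_const_mul _ hcond]
        simp
    _ ≤ 1 + (ENNReal.ofReal s * ENNReal.ofReal (k * (ε / 2)) +
          ENNReal.ofReal (s ^ 2 * (16 / β ^ 2)) * ENNReal.ofReal (M ^ k)) := by
        gcongr
        exact hk₁ k hk μ hμ x
    _ = ENNReal.ofReal (1 + (s * (k * (ε / 2)) + s ^ 2 * (16 / β ^ 2) * M ^ k)) := by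
        rw [← ENNReal.ofReal_one, ← ENNReal.ofReal_mul hspos.le,
          ← ENNReal.ofReal_mul (by positivity), ← ENNReal.ofReal_add (by positivity) (by positivity),
          ← ENNReal.ofReal_add (by positivity) (by positivity)]
    _ ≤ ENNReal.ofReal (Real.exp (s * (k * ε))) := by
        refine ENNReal.ofReal_le_ofReal (le_trans ?_ (Real.add_one_le_exp _))
        have h1 : s * D ≤ k * ε / 2 := by
          have := min_le_right (β / 2) (k * ε / (2 * D))
          rw [← hs, le_div_iff₀ (by positivity)] at this
          linarith
        have h2 : s * (s * D) ≤ s * (k * ε / 2) := mul_le_mul_of_nonneg_left h1 hspos.le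
        have h3 : s ^ 2 * (16 / β ^ 2) * M ^ k = s * (s * D) := by rw [hD]; ring
        rw [h3]
        linarith

/-- Extend a finite sequence of matrices by the identity. -/
def extendOne {d n : ℕ} (p : Fin n → SL d) (i : ℕ) : SL d :=
  if h : i < n then p ⟨i, h⟩ else 1

theorem extendOne_apply {d n : ℕ} (p : Fin n → SL d) {i : ℕ} (h : i < n) :
    extendOne p i = p ⟨i, h⟩ :=
  dif_pos h

theorem extendOne_restrict {d n : ℕ} (ω : ℕ → SL d) {i : ℕ} (h : i < n) :
    extendOne (fun j : Fin n => ω j) i = ω i :=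
  dif_pos h

theorem measurable_extendOne (d n : ℕ) :
    Measurable (extendOne : (Fin n → SL d) → ℕ → SL d) := by
  refine measurable_pi_lambda _ fun i => ?_
  by_cases h : i < n
  · simp only [extendOne, h, dif_pos]
    exact measurable_pi_apply _
  · simp only [extendOne, h, dif_neg, not_false_eq_true]
    exact measurable_const

/-- Conditioning on the first `n` matrices. -/
theorem IsProductMeasure.lintegral_apply {d : ℕ} {μ : ℕ → ProbabilityMeasure (SL d)}
    {ℙ : Measure (ℕ → SL d)} (hℙ : IsProductMeasure μ ℙ) {n : ℕ}
    {F : (ℕ → SL d) → SL d → ℝ≥0∞} (hF : Measurable (Function.uncurry F))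
    (hdep : ∀ ω ω' : ℕ → SL d, (∀ i < n, ω i = ω' i) → F ω = F ω') :
    ∫⁻ ω, F ω (ω n) ∂ℙ = ∫⁻ ω, ∫⁻ A, F ω A ∂(μ n : Measure (SL d)) ∂ℙ := by
  have hres : ∀ k : ℕ, Measurable fun (ω : ℕ → SL d) (i : Fin k) => ω i := fun k =>
    measurable_pi_lambda _ fun i => measurable_pi_apply _
  have hH : Measurable fun p : Fin (n + 1) → SL d => F (extendOne p) (p (Fin.last n)) :=
    hF.comp ((measurable_extendOne d (n + 1)).prodMk (measurable_pi_apply _))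
  have hG' : Measurable fun q : SL d × (Fin n → SL d) => F (extendOne q.2) q.1 :=
    hF.comp (((measurable_extendOne d n).comp measurable_snd).prodMk measurable_fst)
  have hG : Measurable fun q : Fin n → SL d =>
      ∫⁻ A, F (extendOne q) A ∂(μ n : Measure (SL d)) := hG'.lintegral_prod_left'
  have hl : ∀ ω : ℕ → SL d, F ω (ω n) =
      F (extendOne fun i : Fin (n + 1) => ω i) (ω (Fin.last n : Fin (n + 1))) := by
    intro ω
    rw [hdep ω (extendOne fun i : Fin (n + 1) => ω i) fun i hi =>
      (extendOne_restrict ω (hi.trans n.lt_succ_self)).symm, Fin.val_last]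
  have hr : ∀ ω : ℕ → SL d, ∫⁻ A, F ω A ∂(μ n : Measure (SL d)) =
      ∫⁻ A, F (extendOne fun i : Fin n => ω i) A ∂(μ n : Measure (SL d)) := by
    intro ω
    rw [hdep ω (extendOne fun i : Fin n => ω i) fun i hi => (extendOne_restrict ω hi).symm]
  rw [lintegral_congr hl, lintegral_congr hr, ← lintegral_map hH (hres (n + 1)),
    ← lintegral_map hG (hres n), hℙ.2, hℙ.2]
  have hpres := measurePreserving_piFinSuccAbove
    (fun i : Fin (n + 1) => (μ i : Measure (SL d))) (Fin.last n)
  simp only [Fin.succAbove_last, Fin.val_last, Fin.val_castSucc] at hpres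
  rw [← hpres.symm.lintegral_comp hH, ← lintegral_prod_symm' _ hG']
  refine lintegral_congr fun q => ?_
  have hq : (MeasurableEquiv.piFinSuccAbove (fun _ => SL d) (Fin.last n)).symm q =
      Fin.insertNth (α := fun _ => SL d) (Fin.last n) q.1 q.2 := rfl
  rw [hq, Fin.insertNth_apply_same, hdep _ (extendOne q.2) fun i hi => ?_]
  rw [extendOne_apply _ hi, extendOne_apply _ (hi.trans n.lt_succ_self)]
  have := Fin.insertNth_apply_succAbove (α := fun _ => SL d) (Fin.last n) q.1 q.2 ⟨i, hi⟩
  rwa [Fin.succAbove_last] at this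

theorem measurable_T {d : ℕ} (n : ℕ) : Measurable fun ω : ℕ → SL d => T ω n := by
  induction n with
  | zero => exact measurable_const
  | succ n ih => exact (measurable_pi_apply n).mul ih

theorem T_congr {d n : ℕ} {ω ω' : ℕ → SL d} (h : ∀ i < n, ω i = ω' i) : T ω n = T ω' n := by
  induction n with
  | zero => rfl
  | succ n ih => rw [T, T, h n n.lt_succ_self, ih fun i hi => h i (hi.trans n.lt_succ_self)]

/-- Conditioning on the first `n` matrices, the product of the next `i` ones follows
`prodLaw`. -/
theorem IsProductMeasure.lintegral_block {d : ℕ} {μ : ℕ → ProbabilityMeasure (SL d)}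
    {ℙ : Measure (ℕ → SL d)} (hℙ : IsProductMeasure μ ℙ) (n i : ℕ)
    {F : (ℕ → SL d) → SL d → ℝ≥0∞} (hF : Measurable (Function.uncurry F))
    (hdep : ∀ ω ω' : ℕ → SL d, (∀ j < n, ω j = ω' j) → F ω = F ω') :
    ∫⁻ ω, F ω (T ω (n + i) * (T ω n)⁻¹) ∂ℙ =
      ∫⁻ ω, ∫⁻ B, F ω B ∂(prodLaw (fun j => μ (n + j)) i) ∂ℙ := by
  have := hℙ.1
  induction i generalizing F with
  | zero =>
    refine lintegral_congr fun ω => ?_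
    rw [prodLaw, lintegral_dirac' _ hF.of_uncurry_left, add_zero, mul_inv_cancel]
  | succ i ih =>
    have hF' : Measurable (Function.uncurry fun (ω : ℕ → SL d) (A : SL d) =>
        F ω (A * (T ω (n + i) * (T ω n)⁻¹))) :=
      hF.comp (measurable_fst.prodMk (measurable_snd.mul
        (((measurable_T (n + i)).comp measurable_fst).mul
          ((measurable_T n).comp measurable_fst).inv)))
    have hF3 : Measurable fun p : ((ℕ → SL d) × SL d) × SL d => F p.1.1 (p.2 * p.1.2) :=
      hF.comp ((measurable_fst.comp measurable_fst).prodMk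
        (measurable_snd.mul (measurable_snd.comp measurable_fst)))
    have hG : Measurable (Function.uncurry fun (ω : ℕ → SL d) (B : SL d) =>
        ∫⁻ A, F ω (A * B) ∂(μ (n + i) : Measure (SL d))) := hF3.lintegral_prod_right'
    have hstep := hℙ.lintegral_apply (n := n + i) hF' fun ω ω' h => by
      have h' : ∀ j < n, ω j = ω' j := fun j hj => h j (hj.trans_le (n.le_add_right i))
      rw [hdep ω ω' h', T_congr h, T_congr h']
    have hstep' := ih hG fun ω ω' h => by rw [hdep ω ω' h]
    calc ∫⁻ ω, F ω (T ω (n + (i + 1)) * (T ω n)⁻¹) ∂ℙ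
        = ∫⁻ ω, F ω (ω (n + i) * (T ω (n + i) * (T ω n)⁻¹)) ∂ℙ := by
          refine lintegral_congr fun ω => ?_
          rw [← add_assoc, T, mul_assoc]
      _ = ∫⁻ ω, ∫⁻ A, F ω (A * (T ω (n + i) * (T ω n)⁻¹)) ∂(μ (n + i) : Measure (SL d)) ∂ℙ :=
          hstep
      _ = ∫⁻ ω, ∫⁻ B, ∫⁻ A, F ω (A * B) ∂(μ (n + i) : Measure (SL d))
            ∂(prodLaw (fun j => μ (n + j)) i) ∂ℙ := hstep'
      _ = _ := by
          refine lintegral_congr fun ω => ?_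
          have hω : Measurable (F ω) := hF.of_uncurry_left
          rw [prodLaw, Measure.lintegral_mconv hω, lintegral_lintegral_swap]
          exact (hω.comp (measurable_snd.mul measurable_fst)).aemeasurable

/-- The sequence `v_j`, as points of the unit sphere. -/
def sphSeq {d : ℕ} (k : ℕ) (ω : ℕ → SL d) (x : Sph d) : ℕ → Sph d
  | 0 => x
  | j + 1 => sphAct (Bblk k ω j) (sphSeq k ω x j)

theorem vseq_eq_sphSeq {d : ℕ} (k : ℕ) (ω : ℕ → SL d) (x : Sph d) (j : ℕ) :
    vseq k ω x j = sphSeq k ω x j := by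
  induction j with
  | zero => rfl
  | succ j ih =>
    rw [vseq, ih]
    rfl

theorem Rterm_eq_slDefect {d : ℕ} (k : ℕ) (ω : ℕ → SL d) (x : Sph d) (j : ℕ) :
    Rterm k ω x j = slDefect (Bblk k ω j) (sphSeq k ω x j) := by
  rw [Rterm, vseq_eq_sphSeq, slDefect]

theorem measurable_Bblk {d : ℕ} (k j : ℕ) : Measurable fun ω : ℕ → SL d => Bblk k ω j :=
  (measurable_T _).mul (measurable_T _).inv

theorem Bblk_congr {d k j n : ℕ} {ω ω' : ℕ → SL d} (hn : k * (j + 1) ≤ n)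
    (h : ∀ i < n, ω i = ω' i) : Bblk k ω j = Bblk k ω' j := by
  have hle : k * j ≤ n := (Nat.mul_le_mul_left k j.le_succ).trans hn
  rw [Bblk, Bblk, T_congr fun i hi => h i (hi.trans_le hn),
    T_congr fun i hi => h i (hi.trans_le hle)]

theorem measurable_sphSeq {d : ℕ} (k : ℕ) (x : Sph d) (j : ℕ) :
    Measurable fun ω : ℕ → SL d => sphSeq k ω x j := by
  induction j with
  | zero => exact measurable_const
  | succ j ih => exact measurable_sphAct_comp (measurable_Bblk k j) ih

theorem sphSeq_congr {d k j n : ℕ} {ω ω' : ℕ → SL d} (x : Sph d) (hn : k * j ≤ n)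
    (h : ∀ i < n, ω i = ω' i) : sphSeq k ω x j = sphSeq k ω' x j := by
  induction j with
  | zero => rfl
  | succ j ih =>
    rw [sphSeq, sphSeq, Bblk_congr hn h, ih ((Nat.mul_le_mul_left k j.le_succ).trans hn)]

theorem measurable_Rterm {d : ℕ} (hd : 0 < d) (k : ℕ) (x : Sph d) (j : ℕ) :
    Measurable fun ω : ℕ → SL d => Rterm k ω x j := by
  simp_rw [Rterm_eq_slDefect]
  exact measurable_slDefect_comp hd (measurable_Bblk k j) (measurable_sphSeq k x j)

theorem Rterm_congr {d k j n : ℕ} {ω ω' : ℕ → SL d} (x : Sph d) (hn : k * (j + 1) ≤ n)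
    (h : ∀ i < n, ω i = ω' i) : Rterm k ω x j = Rterm k ω' x j := by
  rw [Rterm_eq_slDefect, Rterm_eq_slDefect, Bblk_congr hn h,
    sphSeq_congr x ((Nat.mul_le_mul_left k j.le_succ).trans hn) h]

/-- Exponential moments of the sum of the cancellation terms. -/
theorem IsProductMeasure.lintegral_exp_sum_Rterm_le {d : ℕ} (hd : 0 < d)
    {K : Set (ProbabilityMeasure (SL d))} {k : ℕ} {s : ℝ} {q : ℝ≥0∞}
    (hq : ∀ μ : ℕ → ProbabilityMeasure (SL d), (∀ i, μ i ∈ K) → ∀ x : Sph d,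
      ∫⁻ A, ENNReal.ofReal (Real.exp (s * slDefect A x)) ∂(prodLaw μ k) ≤ q)
    {μ : ℕ → ProbabilityMeasure (SL d)} (hμ : ∀ i, μ i ∈ K) {ℙ : Measure (ℕ → SL d)}
    (hℙ : IsProductMeasure μ ℙ) (x : Sph d) (m : ℕ) :
    ∫⁻ ω, ENNReal.ofReal (Real.exp (s * ∑ j ∈ Finset.range m, Rterm k ω x j)) ∂ℙ ≤ q ^ m := by
  have := hℙ.1
  induction m with
  | zero => simp
  | succ m ih =>
    have hS : Measurable fun ω : ℕ → SL d =>
        ENNReal.ofReal (Real.exp (s * ∑ j ∈ Finset.range m, Rterm k ω x j)) :=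
      ((Finset.measurable_fun_sum _ fun j _ =>
        measurable_Rterm hd k x j).const_mul s).exp.ennreal_ofReal
    let F : (ℕ → SL d) → SL d → ℝ≥0∞ := fun ω B =>
      ENNReal.ofReal (Real.exp (s * ∑ j ∈ Finset.range m, Rterm k ω x j)) *
        ENNReal.ofReal (Real.exp (s * slDefect B (sphSeq k ω x m)))
    have hdef : Measurable fun p : (ℕ → SL d) × SL d => slDefect p.2 (sphSeq k p.1 x m) :=
      measurable_slDefect_comp hd measurable_snd ((measurable_sphSeq k x m).comp measurable_fst)
    have hF : Measurable (Function.uncurry F) :=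
      (hS.comp measurable_fst).mul (hdef.const_mul s).exp.ennreal_ofReal
    have hdep : ∀ ω ω' : ℕ → SL d, (∀ i < k * m, ω i = ω' i) → F ω = F ω' := by
      intro ω ω' h
      have hsum : ∑ j ∈ Finset.range m, Rterm k ω x j = ∑ j ∈ Finset.range m, Rterm k ω' x j :=
        Finset.sum_congr rfl fun j hj =>
          Rterm_congr x (Nat.mul_le_mul_left k (Finset.mem_range.1 hj)) h
      simp only [F]
      rw [hsum, sphSeq_congr x le_rfl h]
    calc ∫⁻ ω, ENNReal.ofReal (Real.exp (s * ∑ j ∈ Finset.range (m + 1), Rterm k ω x j)) ∂ℙ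
        = ∫⁻ ω, F ω (T ω (k * m + k) * (T ω (k * m))⁻¹) ∂ℙ := by
          refine lintegral_congr fun ω => ?_
          rw [Finset.sum_range_succ, mul_add, Real.exp_add,
            ENNReal.ofReal_mul (Real.exp_pos _).le, Rterm_eq_slDefect]
          rfl
      _ = ∫⁻ ω, ∫⁻ B, F ω B ∂(prodLaw (fun j => μ (k * m + j)) k) ∂ℙ :=
          hℙ.lintegral_block (k * m) k hF hdep
      _ ≤ ∫⁻ ω, ENNReal.ofReal (Real.exp (s * ∑ j ∈ Finset.range m, Rterm k ω x j)) * q ∂ℙ := by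
          refine lintegral_mono fun ω => ?_
          rw [lintegral_const_mul _
            ((measurable_slDefect_left hd _).const_mul s).exp.ennreal_ofReal]
          gcongr
          exact hq _ (fun j => hμ _) _
      _ ≤ q ^ (m + 1) := by
          rw [lintegral_mul_const _ hS, pow_succ]
          gcongr

/-- **Large deviations bound for the cancellation terms** (Proposition 3.2).
For any `ε'' > 0` there is `k₁` such that for any `k > k₁` there are `δ'' > 0`, `C''`
such that for all `m`, all choices of measures from `K` and all unit vectors `v₀`,
`ℙ(R₁ + ⋯ + R_m > k m ε'') < C'' e^{-δ'' m}`. -/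
theorem cancellation_large_deviations
    (d : ℕ) (hd : 0 < d)
    (K : Set (ProbabilityMeasure (SL d))) (hK : IsCompact K)
    (γ C : ℝ) (hγ : 0 < γ)
    (hmom : ∀ μ ∈ K, FiniteMomentCondition γ C μ)
    (hmeas : ∀ μ ∈ K, MeasuresCondition μ)
    (hsp : ∀ μ ∈ K, SpacesCondition μ) :
    ∀ ε'' : ℝ, 0 < ε'' → ∃ k₁ : ℕ, ∀ k : ℕ, k₁ < k →
      ∃ δ'' : ℝ, 0 < δ'' ∧ ∃ C'' : ℝ,
        ∀ m : ℕ, ∀ (μ : ℕ → ProbabilityMeasure (SL d)), (∀ i, μ i ∈ K) →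
          ∀ ℙ : Measure (ℕ → SL d), IsProductMeasure μ ℙ →
            ∀ v₀ : EuclideanSpace ℝ (Fin d), ‖v₀‖ = 1 →
              ℙ {ω | ((k * m : ℕ) : ℝ) * ε'' < ∑ j ∈ Finset.range m, Rterm k ω v₀ j} <
                ENNReal.ofReal (C'' * Real.exp (-δ'' * m)) := by
  intro ε hε
  obtain ⟨k₁, hk₁⟩ := exists_forall_lintegral_exp_slDefect_prodLaw_le hd hK hsp hγ hmom
    (half_pos hε)
  refine ⟨k₁, fun k hk => ?_⟩
  obtain ⟨s, hs, hq⟩ := hk₁ k hk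
  have hkpos : (0 : ℝ) < k := by exact_mod_cast (Nat.zero_le k₁).trans_lt hk
  refine ⟨s * (k * (ε / 2)), by positivity, 2, fun m μ hμ ℙ hℙ v₀ hv₀ => ?_⟩
  let x : Sph d := ⟨v₀, mem_sphere_zero_iff_norm.2 hv₀⟩
  have hS : Measurable fun ω : ℕ → SL d =>
      ENNReal.ofReal (Real.exp (s * ∑ j ∈ Finset.range m, Rterm k ω x j)) :=
    ((Finset.measurable_fun_sum _ fun j _ =>
      measurable_Rterm hd k x j).const_mul s).exp.ennreal_ofReal
  set a : ℝ := s * (((k * m : ℕ) : ℝ) * ε) with ha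
  have hmarkov := meas_ge_le_lintegral_div (μ := ℙ) hS.aemeasurable (ε := ENNReal.ofReal (Real.exp a))
    (by simpa using Real.exp_pos a) ENNReal.ofReal_ne_top
  have hexp := hℙ.lintegral_exp_sum_Rterm_le hd hq hμ x m
  calc ℙ {ω | ((k * m : ℕ) : ℝ) * ε < ∑ j ∈ Finset.range m, Rterm k ω v₀ j}
      ≤ ℙ {ω | ENNReal.ofReal (Real.exp a) ≤
          ENNReal.ofReal (Real.exp (s * ∑ j ∈ Finset.range m, Rterm k ω x j))} := by
        refine measure_mono fun ω hω => ?_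
        rw [Set.mem_ofPred_eq] at hω ⊢
        exact ENNReal.ofReal_le_ofReal
          (Real.exp_le_exp.2 (mul_le_mul_of_nonneg_left hω.le hs.le))
    _ ≤ ENNReal.ofReal (Real.exp (s * (k * (ε / 2)))) ^ m / ENNReal.ofReal (Real.exp a) :=
        hmarkov.trans (by gcongr)
    _ = ENNReal.ofReal (Real.exp (-(s * (k * (ε / 2))) * m)) := by
        rw [← ENNReal.ofReal_pow (Real.exp_pos _).le, ← ENNReal.ofReal_div_of_pos (Real.exp_pos _),
          ← Real.exp_nat_mul, ← Real.exp_sub]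
        congr 2
        rw [ha]
        push_cast
        ring
    _ < ENNReal.ofReal (2 * Real.exp (-(s * (k * (ε / 2))) * m)) := by
        have := Real.exp_pos (-(s * (k * (ε / 2))) * m)
        exact (ENNReal.ofReal_lt_ofReal_iff (by positivity)).2 (by linarith)
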